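/- arXiv:math/0403021 — 2 statements merged into one kernel-verified Lean document; each statement's English description precedes it below -/
import Mathlib

section
/- Let k be a field, q a nonzero element of k, and m ≤ n positive integers. For γ ∈ Π_{m,n}, the quantum Schubert variety O_q(G_{m,n}(k))_γ = O_q(G_{m,n}(k))/⟨Ω_γ⟩, where Ω_γ = {π ∈ Π_{m,n} : π ≱st γ}, is a quantum graded algebra with a straightening law on the poset (Π_{m,n}∖Ω_γ, ≤st) (identified with its image in the quotient). -/
/-- A *quantum graded algebra with a straightening law* over the field `k`, on the finite
poset `ι` (whose elements are realised in `A` via the map `elem`). -/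
structure QuantumGradedASL (k : Type*) [Field k] (A : Type*) [Ring A] [Algebra k A]
    (𝒜 : ℕ → Submodule k A) (ι : Type*) [PartialOrder ι] [Finite ι] where
  /-- the map realising the elements of the poset `Π = ι` as elements of `A` -/
  elem : ι → A
  /-- `A` is an `ℕ`-graded `k`-algebra with grading `𝒜` -/
  graded : GradedAlgebra 𝒜
  /-- (1) the elements of `Π` are homogeneous of positive degree -/
  homog : ∀ i : ι, ∃ d : ℕ, 0 < d ∧ elem i ∈ 𝒜 d
  /-- (2) the elements of `Π` generate `A` as a `k`-algebra -/
  gen : Algebra.adjoin k (Set.range elem) = ⊤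
  /-- (3) the standard monomials (products of the `elem i` along nondecreasing lists,
  the empty product being `1`) form a linearly independent family -/
  indep : LinearIndependent k
    (fun l : {l : List ι // l.Chain' (· ≤ ·)} => ((l : List ι).map elem).prod)
  /-- (4) if `a`, `b` are incomparable then `elem a * elem b` is a linear combination of
  terms `elem lam` or `elem lam * elem mu` with `lam ≤ mu`, `lam < a` and `lam < b` -/
  straighten : ∀ a b : ι, ¬ a ≤ b → ¬ b ≤ a →
    elem a * elem b ∈ Submodule.span k {x : A | ∃ lam : ι, lam < a ∧ lam < b ∧
      (x = elem lam ∨ ∃ mu : ι, lam ≤ mu ∧ x = elem lam * elem mu)}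
  /-- (5) for all `a`, `b` there is `0 ≠ c ∈ k` such that `elem a * elem b - c • (elem b * elem a)`
  is a linear combination of terms `elem lam` or `elem lam * elem mu` with `lam ≤ mu`,
  `lam < a` and `lam < b` -/
  comm : ∀ a b : ι, ∃ c : k, c ≠ 0 ∧
    elem a * elem b - c • (elem b * elem a) ∈
      Submodule.span k {x : A | ∃ lam : ι, lam < a ∧ lam < b ∧
        (x = elem lam ∨ ∃ mu : ι, lam ≤ mu ∧ x = elem lam * elem mu)}

/-- The defining relations of the algebra of quantum `m × n` matrices, with parameter the
unit `u`, imposed on the free algebra on the generators `X (i,j)`. -/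
inductive qMatrixRel (R : Type*) [CommRing R] (u : Rˣ) (m n : ℕ) :
    FreeAlgebra R (Fin m × Fin n) → FreeAlgebra R (Fin m × Fin n) → Prop
  | row : ∀ (i : Fin m) (j l : Fin n), j < l →
      qMatrixRel R u m n (FreeAlgebra.ι R (i, j) * FreeAlgebra.ι R (i, l))
        ((u : R) • (FreeAlgebra.ι R (i, l) * FreeAlgebra.ι R (i, j)))
  | col : ∀ (i k : Fin m) (j : Fin n), i < k →
      qMatrixRel R u m n (FreeAlgebra.ι R (i, j) * FreeAlgebra.ι R (k, j))
        ((u : R) • (FreeAlgebra.ι R (k, j) * FreeAlgebra.ι R (i, j)))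
  | antidiag : ∀ (i k : Fin m) (j l : Fin n), k < i → j < l →
      qMatrixRel R u m n (FreeAlgebra.ι R (i, j) * FreeAlgebra.ι R (k, l))
        (FreeAlgebra.ι R (k, l) * FreeAlgebra.ι R (i, j))
  | diag : ∀ (i k : Fin m) (j l : Fin n), i < k → j < l →
      qMatrixRel R u m n (FreeAlgebra.ι R (i, j) * FreeAlgebra.ι R (k, l))
        (FreeAlgebra.ι R (k, l) * FreeAlgebra.ι R (i, j) +
          ((u : R) - ((u⁻¹ : Rˣ) : R)) • (FreeAlgebra.ι R (i, l) * FreeAlgebra.ι R (k, j)))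

/-- The algebra `O_u(M_{m,n}(R))` of quantum `m × n` matrices over `R`. -/
abbrev QuantumMat (R : Type*) [CommRing R] (u : Rˣ) (m n : ℕ) :=
  RingQuot (qMatrixRel R u m n)

/-- The generator `X i j` of the algebra of quantum matrices. -/
def qX (R : Type*) [CommRing R] (u : Rˣ) {m n : ℕ} (i : Fin m) (j : Fin n) :
    QuantumMat R u m n :=
  RingQuot.mkAlgHom R (qMatrixRel R u m n) (FreeAlgebra.ι R (i, j))

/-- The number of inversions (i.e. the Coxeter length) of a permutation of `Fin t`. -/
def permLength {t : ℕ} (σ : Equiv.Perm (Fin t)) : ℕ :=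
  (Finset.univ.filter fun p : Fin t × Fin t => p.1 < p.2 ∧ σ p.2 < σ p.1).card

/-- The index set `Π_{m,n}` of maximal quantum minors consists of the `m`-element subsets
`{j₁ < ⋯ < j_m} ⊆ {1,…,n}`, encoded as order embeddings `Fin m ↪o Fin n`; it carries the
standard partial order `I ≤st J ↔ ∀ s, i_s ≤ j_s` (pointwise order). -/
instance piPartialOrder (m n : ℕ) : PartialOrder (Fin m ↪o Fin n) :=
  PartialOrder.lift (fun f => (f : Fin m → Fin n)) DFunLike.coe_injective

instance piFinite (m n : ℕ) : Finite (Fin m ↪o Fin n) :=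
  Finite.of_injective (fun f => (f : Fin m → Fin n)) DFunLike.coe_injective

/-- The maximal quantum minor `[J] = Σ_{σ ∈ S_m} (−u)^{ℓ(σ)} X_{1 j_{σ(1)}} ⋯ X_{m j_{σ(m)}}`
of the generic matrix, for a column index set `J ∈ Π_{m,n}`. -/
def qMaximalMinor (R : Type*) [CommRing R] (u : Rˣ) {m n : ℕ} (J : Fin m ↪o Fin n) :
    QuantumMat R u m n :=
  ∑ σ : Equiv.Perm (Fin m),
    ((-(u : R)) ^ permLength σ) • (List.ofFn fun i : Fin m => qX R u i (J (σ i))).prod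

/-- The quantum grassmannian `O_q(G_{m,n}(K))`: the `K`-subalgebra of `O_q(M_{m,n}(K))`
generated by the maximal quantum minors `[J]`, `J ∈ Π_{m,n}`. -/
def QuantumGrassmannian (K : Type*) [CommRing K] (u : Kˣ) (m n : ℕ) :
    Subalgebra K (QuantumMat K u m n) :=
  Algebra.adjoin K (Set.range fun J : Fin m ↪o Fin n => qMaximalMinor K u J)

/-- The maximal quantum minor `[J]` viewed as an element of the quantum grassmannian. -/
def grMinor (K : Type*) [CommRing K] (u : Kˣ) {m n : ℕ} (J : Fin m ↪o Fin n) :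
    QuantumGrassmannian K u m n :=
  ⟨qMaximalMinor K u J, Algebra.subset_adjoin ⟨J, rfl⟩⟩

namespace QMat

open Finset

variable {k R : Type*} [Field k] [Ring R] [Algebra k R] {α β : Type*}
  [LinearOrder β]

/-- The entries `x i j` of a matrix over `R` satisfy the defining relations of quantum matrices. -/
structure IsQMat [LinearOrder α] (q : k) (x : α → β → R) : Prop where
  row : ∀ i j l, j < l → x i j * x i l = q • (x i l * x i j)
  col : ∀ i h j, i < h → x i j * x h j = q • (x h j * x i j)
  anti : ∀ i h j l, h < i → j < l → x i j * x h l = x h l * x i j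
  diag : ∀ i h j l, i < h → j < l →
    x i j * x h l = x h l * x i j + (q - q⁻¹) • (x i l * x h j)

theorem IsQMat.transpose [LinearOrder α] {q : k} {x : α → β → R} (hx : IsQMat q x) :
    IsQMat q (fun j i => x i j) where
  row j i h hih := hx.col i h j hih
  col j l i hjl := hx.row i j l hjl
  anti j l i h hlj hih := (hx.anti h i l j hih hlj).symm
  diag j l i h hjl hih := by
    rw [hx.diag i h j l hih hjl, hx.anti h i j l hih hjl]

/-- The number of pairs `(u, v) ∈ U × V` with `v < u`. -/
def inv (U V : Finset β) : ℕ := ∑ u ∈ U, #{v ∈ V | v < u}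

/-- Left multiplication by `∑ j, x i j e_j` on the `q`-exterior algebra with coefficients in `R`,
whose elements are recorded by their coefficients on the basis `e_T`. -/
def wedge (q : k) (x : α → β → R) (i : α) : Module.End k (Finset β → R) where
  toFun a T := ∑ j ∈ T, (-q) ^ #{t ∈ T | t < j} • (x i j * a (T.erase j))
  map_add' a b := by
    ext T
    simp [mul_add, sum_add_distrib]
  map_smul' c a := by
    ext T
    simp only [Pi.smul_apply, mul_smul_comm, RingHom.id_apply, smul_sum]
    exact sum_congr rfl fun j _ => smul_comm _ _ _

theorem wedge_apply (q : k) (x : α → β → R) (i : α) (a : Finset β → R) (T : Finset β) :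
    wedge q x i a T = ∑ j ∈ T, (-q) ^ #{t ∈ T | t < j} • (x i j * a (T.erase j)) := rfl

theorem sum_sum_erase_eq_zero {M : Type*} [AddCommGroup M] (T : Finset β) (G : β → β → M)
    (hG : ∀ j ∈ T, ∀ l ∈ T, j < l → G j l + G l j = 0) :
    ∑ j ∈ T, ∑ l ∈ T.erase j, G j l = 0 := by
  have h1 : ∀ j ∈ T, ∑ l ∈ T.erase j, G j l =
      (∑ l ∈ T, if j < l then G j l else 0) + ∑ l ∈ T, if l < j then G j l else 0 := by
    intro j hj
    rw [← sum_add_distrib, ← add_sum_erase T _ hj]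
    simp only [lt_irrefl, if_false, add_zero, zero_add]
    refine sum_congr rfl fun l hl => ?_
    rcases lt_or_gt_of_ne (ne_of_mem_erase hl) with h | h <;> simp [h, h.not_gt]
  rw [sum_congr rfl h1, sum_add_distrib]
  nth_rewrite 2 [sum_comm]
  rw [← sum_add_distrib]
  refine sum_eq_zero fun j hj => ?_
  rw [← sum_add_distrib]
  refine sum_eq_zero fun l hl => ?_
  split_ifs with h
  · exact hG j hj l hl h
  · simp

theorem card_erase_lt_add_one {T : Finset β} {j l : β} (hj : j ∈ T) (h : j < l) :
    #{t ∈ T | t < l} = #{t ∈ T.erase j | t < l} + 1 := by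
  rw [filter_erase, card_erase_add_one]
  simp [hj, h]

theorem card_erase_lt_of_le {T : Finset β} {j l : β} (h : j ≤ l) :
    #{t ∈ T.erase l | t < j} = #{t ∈ T | t < j} := by
  rw [filter_erase, erase_eq_of_notMem]
  simp [h.not_gt]

theorem wedge_mul_apply (q : k) (x : α → β → R) (i h : α) (a : Finset β → R) (T : Finset β) :
    (wedge q x i * wedge q x h) a T = ∑ j ∈ T, ∑ l ∈ T.erase j,
      ((-q) ^ #{t ∈ T | t < j} * (-q) ^ #{t ∈ T.erase j | t < l}) •
        (x i j * x h l * a ((T.erase j).erase l)) := by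
  rw [Module.End.mul_apply, wedge_apply]
  refine sum_congr rfl fun j _ => ?_
  rw [wedge_apply, mul_sum, smul_sum]
  refine sum_congr rfl fun l _ => ?_
  rw [mul_smul_comm, smul_smul, mul_assoc]

variable [LinearOrder α] {q : k} {x : α → β → R}

theorem IsQMat.wedge_sq (hx : IsQMat q x) (i : α) : wedge q x i * wedge q x i = 0 := by
  ext a T
  rw [wedge_mul_apply]
  refine sum_sum_erase_eq_zero T _ fun j hj l _ h => ?_
  rw [card_erase_lt_of_le h.le, card_erase_lt_add_one hj h, erase_right_comm, hx.row i j l h]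
  simp only [smul_mul_assoc, smul_smul]
  rw [← add_smul, pow_succ]
  convert zero_smul k _
  ring

theorem IsQMat.wedge_comm (hx : IsQMat q x) (hq : q ≠ 0) {i h : α} (hih : i < h) :
    wedge q x i * wedge q x h = (-q)⁻¹ • (wedge q x h * wedge q x i) := by
  rw [← sub_eq_zero]
  ext a T
  rw [LinearMap.sub_apply, Pi.sub_apply, LinearMap.smul_apply, Pi.smul_apply, wedge_mul_apply,
    wedge_mul_apply, smul_sum, ← sum_sub_distrib]
  simp_rw [smul_sum, ← sum_sub_distrib]
  refine sum_sum_erase_eq_zero T _ fun j hj l _ h => ?_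
  rw [card_erase_lt_of_le h.le, card_erase_lt_add_one hj h, erase_right_comm (a := l),
    hx.diag i _ j l hih h, hx.anti _ i j l hih h]
  simp only [add_mul, smul_mul_assoc, smul_smul, smul_add]
  set A := x i l * _ * _
  set B := x _ l * _ * _
  rw [pow_succ]
  match_scalars
  · field_simp; ring
  · field_simp; ring

end QMat

namespace QMat

open Finset

section

variable {k R : Type*} [Field k] [Ring R] [Algebra k R] {α β : Type*} [LinearOrder β]

/-- Left multiplication by the product of the rows of `x` indexed by the word `w`. -/
def wedgeProd (q : k) (x : α → β → R) (w : List α) : Module.End k (Finset β → R) :=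
  (w.map (wedge q x)).prod

/-- The quantum minor of `x` on the rows of the word `w` and the columns in `T`. -/
def minor (q : k) (x : α → β → R) (w : List α) (T : Finset β) : R :=
  wedgeProd q x w (Pi.single ∅ 1) T

variable (q : k) (x : α → β → R)

theorem wedgeProd_append (w w' : List α) :
    wedgeProd q x (w ++ w') = wedgeProd q x w * wedgeProd q x w' := by
  simp [wedgeProd]

theorem minor_nil (T : Finset β) : minor q x [] T = if T = ∅ then 1 else 0 := by
  simp [minor, wedgeProd, Pi.single_apply]

theorem wedgeProd_cons_apply (i : α) (w : List α) (a : Finset β → R) (T : Finset β) :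
    wedgeProd q x (i :: w) a T =
      ∑ j ∈ T, (-q) ^ #{t ∈ T | t < j} • (x i j * wedgeProd q x w a (T.erase j)) := by
  simp [wedgeProd, wedge_apply]

theorem minor_cons (i : α) (w : List α) (T : Finset β) :
    minor q x (i :: w) T =
      ∑ j ∈ T, (-q) ^ #{t ∈ T | t < j} • (x i j * minor q x w (T.erase j)) :=
  wedgeProd_cons_apply q x i w _ T

theorem minor_eq_zero_of_card_ne {w : List α} {T : Finset β} (h : #T ≠ w.length) :
    minor q x w T = 0 := by
  induction w generalizing T with
  | nil =>
    rw [minor_nil, if_neg]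
    rintro rfl
    exact h rfl
  | cons i w ih =>
    rw [minor_cons]
    refine sum_eq_zero fun j hj => ?_
    rw [ih, mul_zero, smul_zero]
    have := card_erase_add_one hj
    simp only [List.length_cons] at h
    omega

theorem inv_insert {U V : Finset β} {j : β} (hj : j ∉ U) :
    inv (insert j U) V = #{v ∈ V | v < j} + inv U V := by
  simp [inv, sum_insert hj]

theorem wedgeProd_apply (w : List α) (a : Finset β → R) (T : Finset β) :
    wedgeProd q x w a T =
      ∑ U ∈ T.powerset, (-q) ^ inv U (T \ U) • (minor q x w U * a (T \ U)) := by
  induction w generalizing T with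
  | nil =>
    rw [sum_eq_single_of_mem ∅ (by simp)]
    · simp [wedgeProd, minor_nil, inv]
    · intro U _ hU
      simp [minor_nil, hU]
  | cons i w ih =>
    rw [wedgeProd_cons_apply]
    simp_rw [minor_cons, ih, mul_sum, smul_sum, sum_mul, smul_sum]
    rw [sum_sigma', sum_sigma']
    refine sum_bij' (fun p _ => ⟨insert p.1 p.2, p.1⟩) (fun p _ => ⟨p.2, p.1.erase p.2⟩) ?_ ?_ ?_
      ?_ ?_
    · rintro ⟨j, U⟩ h
      simp only [mem_sigma, mem_powerset] at h ⊢
      exact ⟨insert_subset h.1 (h.2.trans (erase_subset _ _)), mem_insert_self _ _⟩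
    · rintro ⟨U, j⟩ h
      simp only [mem_sigma, mem_powerset] at h ⊢
      exact ⟨h.1 h.2, erase_subset_erase _ h.1⟩
    · rintro ⟨j, U⟩ h
      simp only [mem_sigma, mem_powerset] at h ⊢
      have hj : j ∉ U := fun hj => by simpa using h.2 hj
      simp [hj]
    · rintro ⟨U, j⟩ h
      simp only [mem_sigma, mem_powerset] at h ⊢
      simp [insert_erase h.2]
    · rintro ⟨j, U⟩ h
      simp only [mem_sigma, mem_powerset] at h
      have hj : j ∉ U := fun hj => by simpa using h.2 hj
      have hT : T.erase j \ U = T \ insert j U := by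
        ext t
        simp only [mem_sdiff, mem_erase, mem_insert]
        tauto
      have hc : #{t ∈ T | t < j} = #{t ∈ insert j U | t < j} + #{t ∈ T \ insert j U | t < j} := by
        rw [← card_union_of_disjoint, ← filter_union, union_sdiff_of_subset]
        · exact insert_subset h.1 (h.2.trans (erase_subset _ _))
        · exact disjoint_filter_filter disjoint_sdiff
      simp only [hT, erase_insert hj, inv_insert hj, mul_smul_comm, smul_mul_assoc, smul_smul,
        ← mul_assoc, ← pow_add, hc]
      congr 2
      ring

theorem minor_append (w w' : List α) (T : Finset β) :
    minor q x (w ++ w') T =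
      ∑ U ∈ T.powerset, (-q) ^ inv U (T \ U) • (minor q x w U * minor q x w' (T \ U)) := by
  rw [minor, wedgeProd_append, Module.End.mul_apply, wedgeProd_apply]
  rfl

theorem card_filter_insert_lt {T : Finset β} {j l : β} (hj : j ∉ T) (h : j < l) :
    #{t ∈ insert j T | t < l} = #{t ∈ T | t < l} + 1 := by
  rw [filter_insert, if_pos h, card_insert_of_notMem]
  simp [hj]

theorem minor_cons_insert (i : α) (w : List α) {T : Finset β} {j : β}
    (hj : ∀ t ∈ T, j < t) :
    minor q x (i :: w) (insert j T) = x i j * minor q x w T +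
      ∑ l ∈ T, (-q) ^ (#{t ∈ T | t < l} + 1) •
        (x i l * minor q x w (insert j (T.erase l))) := by
  have hjT : j ∉ T := fun h => (hj j h).false
  rw [minor_cons, sum_insert hjT, erase_insert hjT]
  congr 1
  · rw [filter_eq_empty_iff.mpr]
    · simp
    · intro t ht
      rcases mem_insert.mp ht with rfl | ht
      · exact lt_irrefl _
      · exact (hj t ht).not_gt
  · refine sum_congr rfl fun l hl => ?_
    rw [card_filter_insert_lt hjT (hj l hl), erase_insert_of_ne (hj l hl).ne]

end

section

variable {k R : Type*} [Field k] [Ring R] [Algebra k R] {α β : Type*} [LinearOrder α]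
  [LinearOrder β] {q : k} {x : α → β → R}

theorem IsQMat.exists_wedgeProd_eq_smul_of_perm (hx : IsQMat q x) (hq : q ≠ 0) {w w' : List α}
    (h : w.Perm w') : ∃ c : k, c ≠ 0 ∧ wedgeProd q x w = c • wedgeProd q x w' := by
  induction h with
  | nil => exact ⟨1, one_ne_zero, by simp⟩
  | cons i _ ih =>
    obtain ⟨c, hc, h⟩ := ih
    refine ⟨c, hc, ?_⟩
    simp only [wedgeProd, List.map_cons, List.prod_cons] at h ⊢
    rw [h, mul_smul_comm]
  | swap i h l =>
    simp only [wedgeProd, List.map_cons, List.prod_cons, ← mul_assoc]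
    rcases lt_trichotomy i h with hih | rfl | hih
    · refine ⟨-q, neg_ne_zero.mpr hq, ?_⟩
      rw [hx.wedge_comm hq hih, smul_mul_assoc, smul_smul, mul_inv_cancel₀ (neg_ne_zero.mpr hq),
        one_smul]
    · exact ⟨1, one_ne_zero, by simp⟩
    · refine ⟨(-q)⁻¹, inv_ne_zero (neg_ne_zero.mpr hq), ?_⟩
      rw [hx.wedge_comm hq hih, smul_mul_assoc]
  | trans _ _ ih₁ ih₂ =>
    obtain ⟨c, hc, h⟩ := ih₁
    obtain ⟨d, hd, h'⟩ := ih₂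
    exact ⟨c * d, mul_ne_zero hc hd, by rw [h, h', smul_smul]⟩

theorem IsQMat.wedgeProd_eq_zero_of_not_nodup (hx : IsQMat q x) (hq : q ≠ 0) {w : List α}
    (h : ¬ w.Nodup) : wedgeProd q x w = 0 := by
  obtain ⟨a, ha⟩ := List.exists_duplicate_iff_not_nodup.mpr h
  obtain ⟨l, hl⟩ := (List.duplicate_iff_sublist.mp ha).exists_perm_append
  obtain ⟨c, -, hc⟩ := hx.exists_wedgeProd_eq_smul_of_perm hq hl
  rw [hc]
  simp [wedgeProd, ← mul_assoc, hx.wedge_sq]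

theorem IsQMat.minor_sort_comm (hx : IsQMat q x) (S : Finset α) (T : Finset β) :
    minor q x S.sort T = minor q (fun j i => x i j) T.sort S := by
  induction hn : #S using Nat.strong_induction_on generalizing S T with
  | _ n ih =>
  subst hn
  rcases S.eq_empty_or_nonempty with rfl | hS
  · rcases T.eq_empty_or_nonempty with rfl | hT
    · simp [minor_nil]
    · rw [minor_eq_zero_of_card_ne, minor_eq_zero_of_card_ne]
      · simpa using hT.card_pos.ne
      · simpa using hT.ne_empty
  rcases T.eq_empty_or_nonempty with rfl | hT
  · rw [minor_eq_zero_of_card_ne, minor_eq_zero_of_card_ne]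
    · simpa using hS.ne_empty
    · simpa using hS.card_pos.ne
  obtain ⟨i, S', hi, rfl⟩ : ∃ i S', (∀ s ∈ S', i < s) ∧ S = insert i S' :=
    ⟨S.min' hS, S.erase (S.min' hS), fun s hs => S.min'_lt_of_mem_erase_min' hS hs,
      (insert_erase (S.min'_mem hS)).symm⟩
  obtain ⟨j, T', hj, rfl⟩ : ∃ j T', (∀ t ∈ T', j < t) ∧ T = insert j T' :=
    ⟨T.min' hT, T.erase (T.min' hT), fun s hs => T.min'_lt_of_mem_erase_min' hT hs,
      (insert_erase (T.min'_mem hT)).symm⟩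
  have hiS : i ∉ S' := fun h => (hi i h).false
  have hjT : j ∉ T' := fun h => (hj j h).false
  rw [sort_insert _ (fun s hs => (hi s hs).le) hiS, sort_insert _ (fun s hs => (hj s hs).le) hjT,
    minor_cons_insert q x i _ hj, minor_cons_insert q _ j _ hi]
  have hlt : #S' < #(insert i S') := by simp [card_insert_of_notMem hiS]
  rw [ih _ hlt S' T' rfl]
  congr 1
  have h1 : ∀ l ∈ T', minor q x S'.sort (insert j (T'.erase l)) =
      ∑ h ∈ S', (-q) ^ #{t ∈ S' | t < h} •
        (x h j * minor q (fun j i => x i j) (T'.erase l).sort (S'.erase h)) := by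
    intro l hl
    rw [ih _ hlt _ _ rfl, sort_insert, minor_cons]
    · exact fun t ht => (hj t (mem_of_mem_erase ht)).le
    · exact fun h => hjT (mem_of_mem_erase h)
  have h2 : ∀ h ∈ S', minor q (fun j i => x i j) T'.sort (insert i (S'.erase h)) =
      ∑ l ∈ T', (-q) ^ #{t ∈ T' | t < l} •
        (x i l * minor q (fun j i => x i j) (T'.erase l).sort (S'.erase h)) := by
    intro h hh
    have hih : i ∉ S'.erase h := fun h => hiS (mem_of_mem_erase h)
    rw [← ih _ _ _ _ rfl, sort_insert, minor_cons]
    · refine sum_congr rfl fun l _ => ?_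
      rw [ih _ _ _ _ rfl]
      exact (card_erase_le).trans_lt hlt
    · exact fun t ht => (hi t (mem_of_mem_erase ht)).le
    · exact hih
    · rw [card_insert_of_notMem hih, card_erase_add_one hh]
      exact hlt
  refine (sum_congr rfl fun l hl => congrArg _ (congrArg _ (h1 l hl))).trans (Eq.trans ?_
    (sum_congr rfl fun h hh => congrArg _ (congrArg _ (h2 h hh))).symm)
  simp_rw [mul_sum, smul_sum]
  rw [sum_comm]
  refine sum_congr rfl fun h hh => sum_congr rfl fun l hl => ?_
  simp only [mul_smul_comm, smul_smul, ← mul_assoc, hx.anti h i j l (hi h hh) (hj l hl)]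
  congr 1
  ring

end

end QMat

namespace QMat

open Finset

theorem permLength_eq_sum {t : ℕ} (σ : Equiv.Perm (Fin t)) :
    permLength σ = ∑ a, ∑ b, if a < b ∧ σ b < σ a then 1 else 0 := by
  rw [permLength, card_filter, ← univ_product_univ, sum_product]

/-- The permutation of `Fin (t + 1)` sending `0` to `j` and acting as `σ` on the rest. -/
def consPerm {t : ℕ} (j : Fin (t + 1)) (σ : Equiv.Perm (Fin t)) : Equiv.Perm (Fin (t + 1)) :=
  j.cycleRange.symm * Equiv.Perm.decomposeFin.symm (0, σ)

@[simp]
theorem consPerm_zero {t : ℕ} (j : Fin (t + 1)) (σ : Equiv.Perm (Fin t)) :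
    consPerm j σ 0 = j := by
  simp [consPerm]

@[simp]
theorem consPerm_succ {t : ℕ} (j : Fin (t + 1)) (σ : Equiv.Perm (Fin t)) (i : Fin t) :
    consPerm j σ i.succ = j.succAbove (σ i) := by
  simp [consPerm]

theorem consPerm_bijective {t : ℕ} :
    Function.Bijective fun p : Fin (t + 1) × Equiv.Perm (Fin t) => consPerm p.1 p.2 := by
  rw [Fintype.bijective_iff_injective_and_card]
  constructor
  · rintro ⟨j, σ⟩ ⟨j', σ'⟩ h
    simp only at h
    obtain rfl : j = j' := by simpa using congrArg (fun τ => τ 0) h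
    refine Prod.ext rfl (Equiv.ext fun i => ?_)
    simpa using congrArg (fun τ => τ i.succ) h
  · simp [Fintype.card_perm, Nat.factorial_succ]

theorem permLength_consPerm {t : ℕ} (j : Fin (t + 1)) (σ : Equiv.Perm (Fin t)) :
    permLength (consPerm j σ) = j + permLength σ := by
  simp only [permLength_eq_sum, Fin.sum_univ_succ, consPerm_zero, consPerm_succ]
  congr 1
  · simp only [lt_self_iff_false, false_and, if_false, zero_add, Fin.succ_pos, true_and]
    rw [Equiv.sum_comp σ (fun i => if j.succAbove i < j then 1 else 0), ← card_filter]
    simp only [Fin.succAbove_lt_iff_castSucc_lt]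
    have : univ.filter (fun i : Fin t => i.castSucc < j) =
        univ.filter (fun i : Fin t => (i : ℕ) < j) := rfl
    rw [this, Fin.card_filter_val_lt]
    omega
  · refine sum_congr rfl fun a _ => ?_
    simp

variable {k R : Type*} [Field k] [Ring R] [Algebra k R] {α β : Type*} [LinearOrder β]

theorem minor_ofFn (q : k) (x : α → β → R) {t : ℕ} (r : Fin t → α) (J : Fin t ↪o β) :
    minor q x (List.ofFn r) (univ.map J.toEmbedding) =
      ∑ σ : Equiv.Perm (Fin t),
        (-q) ^ permLength σ • (List.ofFn fun i => x (r i) (J (σ i))).prod := by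
  induction t with
  | zero => simp [minor_nil, permLength]
  | succ t ih =>
    rw [List.ofFn_succ, minor_cons, sum_map, ← consPerm_bijective.sum_comp,
      ← univ_product_univ, sum_product]
    refine sum_congr rfl fun j _ => ?_
    have h1 : #{s ∈ univ.map J.toEmbedding | s < J.toEmbedding j} = j := by
      rw [filter_map, card_map]
      have : univ.filter ((· < J.toEmbedding j) ∘ J.toEmbedding) = Iio j := by
        ext i
        simp
      rw [this, Fin.card_Iio]
    have h2 : (univ.map J.toEmbedding).erase (J.toEmbedding j) =
        univ.map (j.succAboveOrderEmb.trans J).toEmbedding := by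
      ext s
      simp only [mem_erase, mem_map, mem_univ, true_and]
      constructor
      · rintro ⟨hs, i, rfl⟩
        have : i ≠ j := fun h => hs (by rw [h])
        obtain ⟨l, rfl⟩ := Fin.exists_succAbove_eq this
        exact ⟨l, rfl⟩
      · rintro ⟨l, rfl⟩
        exact ⟨fun h => Fin.succAbove_ne j l (J.injective h), _, rfl⟩
    rw [h1, h2, ih, mul_sum, smul_sum]
    refine sum_congr rfl fun σ _ => ?_
    simp only [permLength_consPerm, List.ofFn_succ, consPerm_zero, consPerm_succ, List.prod_cons,
      mul_smul_comm, smul_smul, pow_add]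
    rfl

end QMat

namespace QMat

open Finset

variable {k R : Type*} [Field k] [Ring R] [Algebra k R] {β : Type*} [LinearOrder β] {m : ℕ}

/-- The maximal quantum minor of `x` on the columns `J`. -/
def qMinor (q : k) (x : Fin m → β → R) (J : Fin m ↪o β) : R :=
  ∑ σ : Equiv.Perm (Fin m), (-q) ^ permLength σ • (List.ofFn fun i => x i (J (σ i))).prod

variable {q : k} {x : Fin m → β → R}

theorem qMinor_eq_minor (q : k) (x : Fin m → β → R) (J : Fin m ↪o β) :
    qMinor q x J = minor q x (univ : Finset (Fin m)).sort (univ.map J.toEmbedding) := by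
  have : (univ : Finset (Fin m)).sort = List.ofFn id := by
    rw [Fin.sort_univ, List.ofFn_id]
  rw [this, minor_ofFn]
  rfl

theorem IsQMat.exists_minor_eq_smul_qMinor (hx : IsQMat q x) (hq : q ≠ 0) {w : List β}
    (hw : w.Nodup) (J : Fin m ↪o β) (hJ : w.toFinset = univ.map J.toEmbedding) :
    ∃ c : k, c ≠ 0 ∧ minor q (fun j i => x i j) w univ = c • qMinor q x J := by
  have hp : w.Perm (univ.map J.toEmbedding).sort := by
    rw [← hJ]
    refine (List.perm_ext_iff_of_nodup hw (sort_nodup _ _)).mpr fun a => ?_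
    simp
  obtain ⟨c, hc, h⟩ := hx.transpose.exists_wedgeProd_eq_smul_of_perm hq hp
  refine ⟨c, hc, ?_⟩
  rw [qMinor_eq_minor, hx.minor_sort_comm, minor, h]
  rfl

theorem IsQMat.minor_eq_zero_or (hx : IsQMat q x) (hq : q ≠ 0) (w : List β) :
    minor q (fun j i => x i j) w univ = 0 ∨ w.Nodup ∧ ∃ J : Fin m ↪o β,
      w.toFinset = univ.map J.toEmbedding ∧
        ∃ c : k, minor q (fun j i => x i j) w univ = c • qMinor q x J := by
  by_cases hw : w.Nodup
  · by_cases hl : w.length = m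
    · right
      have hc : #w.toFinset = m := by rw [List.toFinset_card_of_nodup hw, hl]
      have hJ : w.toFinset = univ.map (w.toFinset.orderEmbOfFin hc).toEmbedding := by
        simp
      obtain ⟨c, -, h⟩ := hx.exists_minor_eq_smul_qMinor hq hw _ hJ
      exact ⟨hw, _, hJ, c, h⟩
    · left
      apply minor_eq_zero_of_card_ne
      simpa using Ne.symm hl
  · left
    rw [minor, hx.transpose.wedgeProd_eq_zero_of_not_nodup hq hw]
    rfl

theorem IsQMat.garnir (hx : IsQMat q x) (hq : q ≠ 0) (A B : List β) (T : Finset β)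
    (h : A.length + B.length < m) :
    ∑ U ∈ T.powerset, (-q) ^ inv U (T \ U) •
      (minor q (fun j i => x i j) (A ++ U.sort) univ *
        minor q (fun j i => x i j) ((T \ U).sort ++ B) univ) = 0 := by
  have key : ∀ P S : Finset (Fin m), minor q (fun j i => x i j) A P *
      minor q x (Pᶜ.sort ++ S.sort) T * minor q (fun j i => x i j) B Sᶜ = 0 := by
    intro P S
    by_cases hP : #P = A.length
    · by_cases hS : #Sᶜ = B.length
      · rw [minor, minor, hx.wedgeProd_eq_zero_of_not_nodup hq]
        · simp
        · intro hn
          have := hn.length_le_card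
          have h1 := card_add_card_compl P
          have h2 := card_add_card_compl S
          simp only [List.length_append, length_sort, Fintype.card_fin] at this h1 h2
          omega
      · rw [minor_eq_zero_of_card_ne _ _ hS, mul_zero]
    · rw [minor_eq_zero_of_card_ne _ _ hP, zero_mul, zero_mul]
  have expand : ∀ U ∈ T.powerset, (-q) ^ inv U (T \ U) •
      (minor q (fun j i => x i j) (A ++ U.sort) univ *
        minor q (fun j i => x i j) ((T \ U).sort ++ B) univ) =
      ∑ P : Finset (Fin m), ∑ S : Finset (Fin m), ((-q) ^ inv P Pᶜ * (-q) ^ inv S Sᶜ) •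
        (minor q (fun j i => x i j) A P *
          ((-q) ^ inv U (T \ U) • (minor q x Pᶜ.sort U * minor q x S.sort (T \ U))) *
          minor q (fun j i => x i j) B Sᶜ) := by
    intro U _
    simp only [minor_append, powerset_univ, sum_mul_sum, smul_sum, ← compl_eq_univ_sdiff,
      hx.minor_sort_comm, mul_smul_comm, smul_mul_assoc, smul_smul, mul_assoc]
    refine sum_congr rfl fun P _ => sum_congr rfl fun S _ => ?_
    congr 1
    ring
  rw [sum_congr rfl expand, sum_comm]
  refine sum_eq_zero fun P _ => ?_
  rw [sum_comm]
  refine sum_eq_zero fun S _ => ?_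
  rw [← smul_sum, ← sum_mul, ← mul_sum, ← minor_append, key, smul_zero]

end QMat

namespace QMat

open Finset

theorem pi_le_iff {m n : ℕ} {I J : Fin m ↪o Fin n} : I ≤ J ↔ ∀ i, I i ≤ J i := Iff.rfl

theorem sum_lt_sum_of_exchange {n : ℕ} {U V W : Finset (Fin n)} {a b : Fin n} (hab : a < b)
    (hV : ∀ v ∈ V, b ≤ v) (hW : ∀ w ∈ W, w ≤ a) (hU : U ⊆ V ∪ W) (hc : #U = #V) (hne : U ≠ V) :
    ∑ u ∈ U, (u : ℕ) < ∑ v ∈ V, (v : ℕ) := by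
  have h1 : ∑ u ∈ U \ V, (u : ℕ) ≤ #(U \ V) * a := by
    rw [← smul_eq_mul]
    refine sum_le_card_nsmul _ _ _ fun u hu => ?_
    rw [mem_sdiff] at hu
    exact hW u ((mem_union.mp (hU hu.1)).resolve_left hu.2)
  have h2 : #(V \ U) * b ≤ ∑ u ∈ V \ U, (u : ℕ) := by
    rw [← smul_eq_mul]
    exact card_nsmul_le_sum _ _ _ fun v hv => hV v (mem_sdiff.mp hv).1
  have h3 : #(U \ V) = #(V \ U) := card_sdiff_comm hc
  have h4 : 0 < #(V \ U) := by
    rw [card_pos, sdiff_nonempty]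
    exact fun h => hne (eq_of_subset_of_card_le h hc.le).symm
  have h5 := sum_inter_add_sum_sdiff U V (fun u => (u : ℕ))
  have h6 := sum_inter_add_sum_sdiff V U (fun u => (u : ℕ))
  rw [inter_comm] at h6
  have h7 : #(V \ U) * (a : ℕ) < #(V \ U) * b := Nat.mul_lt_mul_of_pos_left hab h4
  rw [h3] at h1
  omega

variable {k R : Type*} [Field k] [Ring R] [Algebra k R] {m n : ℕ} {q : k}
  {x : Fin m → Fin n → R}

theorem IsQMat.qMinor_mul_mem_span_sum_lt (hx : IsQMat q x) (hq : q ≠ 0) {I J : Fin m ↪o Fin n}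
    (hIJ : ¬ I ≤ J) :
    qMinor q x I * qMinor q x J ∈ Submodule.span k {z | ∃ K L : Fin m ↪o Fin n,
      ∑ i, (K i : ℕ) < ∑ i, (I i : ℕ) ∧ z = qMinor q x K * qMinor q x L} := by
  rw [pi_le_iff, not_forall] at hIJ
  obtain ⟨s, hs⟩ := hIJ
  rw [not_le] at hs
  set A := (univ.filter (· < s)).map I.toEmbedding with hA
  set V := (univ.filter (¬ · < s)).map I.toEmbedding with hV
  set W := (univ.filter (· ≤ s)).map J.toEmbedding with hW
  set B := (univ.filter (¬ · ≤ s)).map J.toEmbedding with hB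
  have hAV : Disjoint A V := by
    rw [hA, hV, disjoint_map]
    exact disjoint_filter_filter_not _ _ _
  have hWB : Disjoint W B := by
    rw [hW, hB, disjoint_map]
    exact disjoint_filter_filter_not _ _ _
  have hI : A ∪ V = univ.map I.toEmbedding := by
    rw [hA, hV, ← map_union, filter_union_filter_not_eq]
  have hJ : W ∪ B = univ.map J.toEmbedding := by
    rw [hW, hB, ← map_union, filter_union_filter_not_eq]
  have hVge : ∀ v ∈ V, I s ≤ v := by
    intro v hv
    simp only [hV, mem_map, mem_filter, mem_univ, true_and, not_lt] at hv
    obtain ⟨i, hi, rfl⟩ := hv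
    exact I.monotone hi
  have hWle : ∀ w ∈ W, w ≤ J s := by
    intro v hv
    simp only [hW, mem_map, mem_filter, mem_univ, true_and] at hv
    obtain ⟨i, hi, rfl⟩ := hv
    exact J.monotone hi
  have hVW : Disjoint V W := by
    rw [disjoint_left]
    intro a ha ha'
    exact absurd ((hVge a ha).trans (hWle a ha')) (not_le.mpr hs)
  have hlen : A.sort.length + B.sort.length < m := by
    have h1 : #(univ.filter (· < s)) = s := by
      rw [filter_gt_eq_Iio, Fin.card_Iio]
    have h2 : #(univ.filter (· ≤ s)) = s + 1 := by
      rw [filter_ge_eq_Iic, Fin.card_Iic]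
    have h3 := card_filter_add_card_filter_not (s := (univ : Finset (Fin m))) (· ≤ s)
    simp only [hA, hB, length_sort, card_map]
    rw [card_univ, Fintype.card_fin] at h3
    omega
  have hG := hx.garnir hq A.sort B.sort (V ∪ W) hlen
  have hVmem : V ∈ (V ∪ W).powerset := mem_powerset.mpr subset_union_left
  rw [← add_sum_erase _ _ hVmem, add_eq_zero_iff_eq_neg, union_sdiff_cancel_left hVW] at hG
  have nodup_append : ∀ {P Q : Finset (Fin n)}, Disjoint P Q → (P.sort ++ Q.sort).Nodup := by
    intro P Q h
    refine List.Nodup.append (sort_nodup _ _) (sort_nodup _ _) ?_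
    intro a ha hb
    rw [mem_sort] at ha hb
    exact disjoint_left.mp h ha hb
  have toFinset_append : ∀ P Q : Finset (Fin n), (P.sort ++ Q.sort).toFinset = P ∪ Q := by
    intro P Q
    simp
  obtain ⟨c, hc, hcI⟩ := hx.exists_minor_eq_smul_qMinor hq (nodup_append hAV) I
    ((toFinset_append _ _).trans hI)
  obtain ⟨d, hd, hdJ⟩ := hx.exists_minor_eq_smul_qMinor hq (nodup_append hWB) J
    ((toFinset_append _ _).trans hJ)
  rw [hcI, hdJ, smul_mul_smul_comm, smul_smul] at hG
  have he : (-q) ^ inv V W * (c * d) ≠ 0 :=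
    mul_ne_zero (pow_ne_zero _ (neg_ne_zero.mpr hq)) (mul_ne_zero hc hd)
  rw [← Submodule.smul_mem_iff _ he, hG]
  refine Submodule.neg_mem _ (Submodule.sum_mem _ fun U hU => Submodule.smul_mem _ _ ?_)
  rw [mem_erase, mem_powerset] at hU
  rcases hx.minor_eq_zero_or hq (A.sort ++ U.sort) with h | ⟨hn, K, hK, c, h⟩
  · simp [h]
  rcases hx.minor_eq_zero_or hq (((V ∪ W) \ U).sort ++ B.sort) with h' | ⟨-, L, -, d, h'⟩
  · simp [h']
  rw [h, h', smul_mul_smul_comm]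
  refine Submodule.smul_mem _ _ (Submodule.subset_span ⟨K, L, ?_, rfl⟩)
  rw [toFinset_append] at hK
  have hAU : Disjoint A U := by
    rw [disjoint_left]
    intro a ha hb
    exact (List.nodup_append'.mp hn).2.2 ((mem_sort _).mpr ha) ((mem_sort _).mpr hb)
  have hcard : #U = #V := by
    have h1 : #(A ∪ U) = #(A ∪ V) := by rw [hK, hI, card_map, card_map]
    rw [card_union_of_disjoint hAU, card_union_of_disjoint hAV] at h1
    omega
  have hsum := sum_lt_sum_of_exchange hs hVge hWle hU.2 hcard hU.1
  have hKs : ∑ i, (K i : ℕ) = ∑ a ∈ A ∪ U, (a : ℕ) := by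
    rw [hK, sum_map]
    rfl
  have hIs : ∑ i, (I i : ℕ) = ∑ a ∈ A ∪ V, (a : ℕ) := by
    rw [hI, sum_map]
    rfl
  rw [hKs, hIs, sum_union hAU, sum_union hAV]
  omega

theorem IsQMat.qMinor_mul_mem_span_standard (hx : IsQMat q x) (hq : q ≠ 0)
    (I J : Fin m ↪o Fin n) :
    qMinor q x I * qMinor q x J ∈ Submodule.span k {z | ∃ K L : Fin m ↪o Fin n,
      K ≤ L ∧ z = qMinor q x K * qMinor q x L} := by
  induction hN : ∑ i, (I i : ℕ) using Nat.strong_induction_on generalizing I J with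
  | _ N ih =>
  subst hN
  by_cases hIJ : I ≤ J
  · exact Submodule.subset_span ⟨I, J, hIJ, rfl⟩
  · refine Submodule.span_le.mpr ?_ (hx.qMinor_mul_mem_span_sum_lt hq hIJ)
    rintro _ ⟨K, L, hlt, rfl⟩
    exact ih _ hlt K L rfl

end QMat

namespace QMat

open Finset

theorem le_of_forall_le_apply_perm {m : ℕ} {β : Type*} [LinearOrder β] {γ J : Fin m ↪o β}
    (σ : Equiv.Perm (Fin m)) (h : ∀ i, γ i ≤ J (σ i)) (i : Fin m) : γ i ≤ J i := by
  by_contra! hi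
  have hsub : (Ici i).map σ.toEmbedding ⊆ Ioi i := by
    intro a ha
    simp only [mem_map, mem_Ici] at ha
    obtain ⟨b, hb, rfl⟩ := ha
    rw [mem_Ioi, ← J.lt_iff_lt]
    exact hi.trans_le ((γ.monotone hb).trans (h b))
  have hcard := card_le_card hsub
  rw [card_map, Fin.card_Ici, Fin.card_Ioi] at hcard
  omega

variable {k R : Type*} [Field k] [Ring R] [Algebra k R] {m n : ℕ} {q : k}
  {x : Fin m → Fin n → R} {γ : Fin m ↪o Fin n}

theorem prod_ofFn_eq_zero_of_zero (hz : ∀ i j, j < γ i → x i j = 0) {J : Fin m → Fin n}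
    (h : ∃ i, J i < γ i) : (List.ofFn fun i => x i (J i)).prod = 0 := by
  obtain ⟨i, hi⟩ := h
  apply List.prod_eq_zero
  rw [List.mem_ofFn]
  exact ⟨i, hz i _ hi⟩

theorem qMinor_eq_zero_of_zero (hz : ∀ i j, j < γ i → x i j = 0) {J : Fin m ↪o Fin n}
    (h : ¬ γ ≤ J) : qMinor q x J = 0 := by
  refine sum_eq_zero fun σ _ => ?_
  rw [prod_ofFn_eq_zero_of_zero hz, smul_zero]
  by_contra! hσ
  exact h (le_of_forall_le_apply_perm σ hσ)

theorem qMinor_self_of_zero (hz : ∀ i j, j < γ i → x i j = 0) :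
    qMinor q x γ = (List.ofFn fun i => x i (γ i)).prod := by
  rw [qMinor, sum_eq_single (1 : Equiv.Perm (Fin m))]
  · have : permLength (1 : Equiv.Perm (Fin m)) = 0 := by
      rw [permLength, card_eq_zero, filter_eq_empty_iff]
      rintro ⟨a, b⟩ - ⟨h1, h2⟩
      exact lt_asymm h1 h2
    simp [this]
  · intro σ _ hσ
    rw [prod_ofFn_eq_zero_of_zero hz, smul_zero]
    by_contra! h
    refine hσ (Equiv.ext fun i => ?_)
    have h1 : ∀ i : Fin m, (i : ℕ) ≤ (σ i : ℕ) := fun i => γ.le_iff_le.mp (h i)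
    have hs : ∑ i : Fin m, (i : ℕ) = ∑ i, (σ i : ℕ) := (Equiv.sum_comp σ fun i => (i : ℕ)).symm
    exact (Fin.ext ((sum_eq_sum_iff_of_le fun i _ => h1 i).mp hs i (mem_univ i))).symm
  · simp

theorem ofFn_prod_mul_comm {t : ℕ} {a : Fin t → R} {y : R} {c : Fin t → k}
    (h : ∀ i, a i * y = c i • (y * a i)) :
    (List.ofFn a).prod * y = (∏ i, c i) • (y * (List.ofFn a).prod) := by
  induction t with
  | zero => simp
  | succ t ih =>
    rw [List.ofFn_succ, List.prod_cons, Fin.prod_univ_succ, mul_assoc, ih fun i => h i.succ,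
      mul_smul_comm, ← mul_assoc, h 0, smul_mul_assoc, smul_smul, mul_comm, mul_assoc]

theorem mul_ofFn_prod_comm {t : ℕ} {a : Fin t → R} {y : R} {c : Fin t → k}
    (h : ∀ i, y * a i = c i • (a i * y)) :
    y * (List.ofFn a).prod = (∏ i, c i) • ((List.ofFn a).prod * y) := by
  induction t with
  | zero => simp
  | succ t ih =>
    rw [List.ofFn_succ, List.prod_cons, Fin.prod_univ_succ, ← mul_assoc, h 0, smul_mul_assoc,
      mul_assoc, ih fun i => h i.succ, mul_smul_comm, smul_smul, mul_assoc]

theorem IsQMat.pivot_mul_comm (hx : IsQMat q x) (hq : q ≠ 0) (hz : ∀ i j, j < γ i → x i j = 0)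
    {h : Fin m} {l : Fin n} (hl : γ h ≤ l) (i : Fin m) :
    x i (γ i) * x h l =
      ((if i = h then q else 1) * (if γ i = l then q⁻¹ else 1)) • (x h l * x i (γ i)) := by
  rcases lt_trichotomy i h with hi | rfl | hi
  · have hil : γ i < l := (γ.lt_iff_lt.mpr hi).trans_le hl
    rw [if_neg hi.ne, if_neg hil.ne, hx.diag i h _ l hi hil, hz h (γ i) (γ.lt_iff_lt.mpr hi)]
    simp
  · rcases hl.eq_or_lt with rfl | hl
    · simp [hq]
    · rw [if_pos rfl, if_neg hl.ne, hx.row i _ _ hl, mul_one]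
  · rw [if_neg hi.ne']
    rcases lt_trichotomy (γ i) l with hil | rfl | hil
    · rw [if_neg hil.ne, hx.anti i h _ _ hi hil]
      simp
    · rw [if_pos rfl, hx.col h i _ hi]
      simp [smul_smul, hq]
    · rw [if_neg hil.ne', hx.diag h i l _ hi hil, hz i l hil]
      simp

theorem IsQMat.qMinor_self_mul_comm (hx : IsQMat q x) (hq : q ≠ 0)
    (hz : ∀ i j, j < γ i → x i j = 0) (J : Fin m ↪o Fin n) :
    ∃ c : k, c ≠ 0 ∧ qMinor q x γ * qMinor q x J = c • (qMinor q x J * qMinor q x γ) := by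
  set f : Fin n → k := fun l => q * ∏ i, if γ i = l then q⁻¹ else 1 with hf
  have hf0 : ∀ l, f l ≠ 0 := fun l =>
    mul_ne_zero hq (prod_ne_zero_iff.mpr fun i _ => by split_ifs <;> simp [hq])
  have hcomm : ∀ h l, qMinor q x γ * x h l = f l • (x h l * qMinor q x γ) := by
    intro h l
    rcases lt_or_ge l (γ h) with hl | hl
    · simp [hz h l hl]
    · rw [qMinor_self_of_zero hz, ofFn_prod_mul_comm (hx.pivot_mul_comm hq hz hl),
        prod_mul_distrib, prod_ite_eq' univ h fun _ => q, if_pos (mem_univ _)]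
  refine ⟨∏ i, f (J i), prod_ne_zero_iff.mpr fun i _ => hf0 _, ?_⟩
  nth_rewrite 2 [qMinor]
  nth_rewrite 2 [qMinor]
  rw [mul_sum, sum_mul, smul_sum]
  refine sum_congr rfl fun σ _ => ?_
  rw [mul_smul_comm, mul_ofFn_prod_comm (fun i => hcomm i (J (σ i))), smul_mul_assoc,
    smul_comm, Equiv.prod_comp σ fun i => f (J i)]

end QMat

namespace QMat

open Finset

variable {k : Type*} [Field k] {m n : ℕ}

/-- The standard monomials, encoded as nondecreasing lists, all of whose factors are `≥ γ`. -/
abbrev StdList (γ : Fin m ↪o Fin n) :=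
  {l : List (Fin m ↪o Fin n) // l.Pairwise (· ≤ ·) ∧ ∀ J ∈ l, γ ≤ J}

/-- A quantum matrix of operators vanishing below `γ`, in whose maximal minors the standard
monomials above `γ` are linearly independent. -/
structure IsModel (q : k) (γ : Fin m ↪o Fin n) {V : Type*} [AddCommGroup V] [Module k V]
    (x : Fin m → Fin n → Module.End k V) : Prop where
  isQMat : IsQMat q x
  zero : ∀ i j, j < γ i → x i j = 0
  indep : LinearIndependent k fun l : StdList γ => (l.1.map (qMinor q x)).prod

open Polynomial in
/-- The model attached to the largest element of the poset. -/
noncomputable def topModel (k : Type*) [Field k] (γ : Fin m ↪o Fin n) (i : Fin m) (j : Fin n) :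
    Module.End k k[X] :=
  Algebra.lmul k k[X] (if j = γ i then if (i : ℕ) = 0 then X else 1 else 0)

open Polynomial in
theorem isModel_topModel (q : k) (hm : 0 < m) {γ : Fin m ↪o Fin n} (hγ : ∀ J, γ ≤ J → J = γ) :
    IsModel q γ (topModel k γ) := by
  have hzero : ∀ i j, j ≠ γ i → topModel k γ i j = 0 := by
    intro i j h
    simp [topModel, h]
  have hcomm : ∀ i j h l, topModel k γ i j * topModel k γ h l =
      topModel k γ h l * topModel k γ i j := by
    intro i j h l
    simp only [topModel, ← map_mul, mul_comm]
  have hz : ∀ i j, j < γ i → topModel k γ i j = 0 := fun i j h => hzero i j h.ne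
  refine ⟨⟨?_, ?_, ?_, ?_⟩, hz, ?_⟩
  · intro i j l hjl
    by_cases hj : j = γ i
    · rw [hzero i l (hj ▸ hjl.ne')]
      simp
    · rw [hzero i j hj]
      simp
  · intro i h j hih
    by_cases hj : j = γ i
    · rw [hzero h j (by rw [hj]; exact γ.injective.ne hih.ne)]
      simp
    · rw [hzero i j hj]
      simp
  · intro i h j l _ _
    exact hcomm _ _ _ _
  · intro i h j l hih hjl
    rw [hcomm, left_eq_add]
    by_cases hl : l = γ i
    · rw [hzero h j, mul_zero, smul_zero]
      exact (hjl.trans (hl ▸ γ.lt_iff_lt.mpr hih)).ne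
    · rw [hzero i l hl, zero_mul, smul_zero]
  · have hself : qMinor q (topModel k γ) γ = Algebra.lmul k k[X] X := by
      rw [qMinor_self_of_zero hz]
      obtain ⟨t, rfl⟩ : ∃ t, m = t + 1 := ⟨m - 1, by omega⟩
      have h1 : LinearMap.mul k k[X] 1 = 1 := LinearMap.ext fun p => one_mul p
      simp [List.ofFn_succ, topModel, h1]
    have hprod : ∀ l : StdList γ,
        (l.1.map (qMinor q (topModel k γ))).prod = Algebra.lmul k k[X] (X ^ l.1.length) := by
      intro l
      rw [map_pow, ← hself]
      conv_lhs => rw [List.eq_replicate_of_mem fun J hJ => hγ J (l.2.2 J hJ)]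
      simp
    simp_rw [hprod]
    have hinj : Function.Injective fun l : StdList γ => l.1.length := by
      intro l l' h
      apply Subtype.ext
      rw [List.eq_replicate_of_mem fun J hJ => hγ J (l.2.2 J hJ),
        List.eq_replicate_of_mem fun J hJ => hγ J (l'.2.2 J hJ)]
      exact congrArg (List.replicate · γ) h
    have h1 : LinearIndependent k fun d : ℕ => (X ^ d : k[X]) := by
      have := (basisMonomials k).linearIndependent
      simpa [coe_basisMonomials, ← X_pow_eq_monomial] using this
    exact (h1.comp _ hinj).map' (Algebra.lmul k k[X]).toLinearMap
      (LinearMap.ker_eq_bot.mpr Algebra.lmul_injective)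

end QMat

namespace QMat

open Finset

variable {k : Type*} [Field k] {m n : ℕ} {V : Type*} [AddCommGroup V] [Module k V]

/-- The scalar by which column `j` of the lifted model acts in each degree. -/
def liftWeight (q : k) (a a' j : Fin n) : k := if j = a then q⁻¹ else if j = a' then q else 1

/-- The model on `ℕ → V` obtained from `x` by adding to column `a` a shifted copy of the
column `a'` of `x`. -/
def liftModel (q : k) (a a' : Fin n) (x : Fin m → Fin n → Module.End k V) (i : Fin m)
    (j : Fin n) : Module.End k (ℕ → V) where
  toFun f d := liftWeight q a a' j ^ d • x i j (f d) + if j = a then x i a' (f (d + 1)) else 0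
  map_add' f g := by
    ext d
    by_cases h : j = a
    · simp only [h, Pi.add_apply, map_add, smul_add, if_true]
      abel
    · simp [h]
  map_smul' c f := by
    ext d
    by_cases h : j = a
    · simp [h, smul_comm c]
    · simp [h, smul_comm c]

variable {q : k} {a a' : Fin n} {x : Fin m → Fin n → Module.End k V}

theorem liftModel_apply (i : Fin m) (j : Fin n) (f : ℕ → V) (d : ℕ) :
    liftModel q a a' x i j f d =
      liftWeight q a a' j ^ d • x i j (f d) + if j = a then x i a' (f (d + 1)) else 0 := rfl

theorem liftModel_apply_left (i : Fin m) (f : ℕ → V) (d : ℕ) :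
    liftModel q a a' x i a f d = (q ^ d)⁻¹ • x i a (f d) + x i a' (f (d + 1)) := by
  simp [liftModel_apply, liftWeight]

theorem liftModel_apply_right (h : a ≠ a') (i : Fin m) (f : ℕ → V) (d : ℕ) :
    liftModel q a a' x i a' f d = q ^ d • x i a' (f d) := by
  simp [liftModel_apply, liftWeight, h.symm]

theorem liftModel_apply_of_ne {j : Fin n} (h : j ≠ a) (h' : j ≠ a') (i : Fin m) (f : ℕ → V)
    (d : ℕ) : liftModel q a a' x i j f d = x i j (f d) := by
  simp [liftModel_apply, liftWeight, h, h']

theorem IsQMat.liftModel (hx : IsQMat q x) (hq : q ≠ 0) (haa' : (a' : ℕ) = a + 1) :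
    IsQMat q (liftModel q a a' x) := by
  have hlt : a < a' := by
    rw [Fin.lt_def]
    omega
  have hgt : ∀ {j}, a < j → j ≠ a' → a' < j := by
    intro j h h'
    rw [Fin.lt_def] at h ⊢
    have := Fin.val_ne_of_ne h'
    omega
  have row : ∀ i j l v, j < l → x i j (x i l v) = q • x i l (x i j v) := fun i j l v h =>
    congrArg (fun T : Module.End k V => T v) (hx.row i j l h)
  have col : ∀ i h j v, i < h → x i j (x h j v) = q • x h j (x i j v) := fun i h j v hh =>
    congrArg (fun T : Module.End k V => T v) (hx.col i h j hh)
  have anti : ∀ i h j l v, h < i → j < l → x i j (x h l v) = x h l (x i j v) :=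
    fun i h j l v hh hl => congrArg (fun T : Module.End k V => T v) (hx.anti i h j l hh hl)
  have diag : ∀ i h j l v, i < h → j < l →
      x i j (x h l v) = x h l (x i j v) + (q - q⁻¹) • x i l (x h j v) :=
    fun i h j l v hh hl => congrArg (fun T : Module.End k V => T v) (hx.diag i h j l hh hl)
  refine ⟨?_, ?_, ?_, ?_⟩
  · intro i j l hjl
    ext f d
    simp only [Module.End.mul_apply, LinearMap.smul_apply, Pi.smul_apply]
    by_cases hj : j = a
    · subst hj
      by_cases hl : l = a'
      · subst hl
        simp only [liftModel_apply_left, liftModel_apply_right hlt.ne, map_add, map_smul,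
          row i j l _ hlt]
        match_scalars <;> field_simp
        ring
      · simp only [liftModel_apply_left, liftModel_apply_of_ne hjl.ne' hl, map_add, map_smul,
          row i j l _ hjl, row i a' l _ (hgt hjl hl)]
        module
    · by_cases hj' : j = a'
      · subst hj'
        simp only [liftModel_apply_right hlt.ne, liftModel_apply_of_ne (hlt.trans hjl).ne' hjl.ne',
          map_smul, row i j l _ hjl]
        module
      · by_cases hl : l = a
        · subst hl
          simp only [liftModel_apply_left, liftModel_apply_of_ne hj hj', map_add, map_smul,
            row i j l _ hjl, row i j a' _ (hjl.trans hlt)]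
          module
        · by_cases hl' : l = a'
          · subst hl'
            simp only [liftModel_apply_right hlt.ne, liftModel_apply_of_ne hj hj', map_smul,
              row i j l _ hjl]
            module
          · simp only [liftModel_apply_of_ne hj hj', liftModel_apply_of_ne hl hl',
              row i j l _ hjl]
  · intro i h j hih
    ext f d
    simp only [Module.End.mul_apply, LinearMap.smul_apply, Pi.smul_apply]
    by_cases hj : j = a
    · subst hj
      simp only [liftModel_apply_left, map_add, map_smul, col i h _ _ hih, diag i h j a' _ hih hlt,
        anti h i j a' _ hih hlt, pow_succ]
      match_scalars <;> field_simp
      ring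
    · by_cases hj' : j = a'
      · subst hj'
        simp only [liftModel_apply_right hlt.ne, map_smul, col i h _ _ hih]
        module
      · simp only [liftModel_apply_of_ne hj hj', col i h _ _ hih]
  · intro i h j l hhi hjl
    ext f d
    simp only [Module.End.mul_apply]
    by_cases hj : j = a
    · subst hj
      by_cases hl : l = a'
      · subst hl
        simp only [liftModel_apply_left, liftModel_apply_right hlt.ne, map_add, map_smul,
          anti i h j l _ hhi hlt, col h i l _ hhi]
        match_scalars <;> field_simp
        ring
      · simp only [liftModel_apply_left, liftModel_apply_of_ne hjl.ne' hl, map_add, map_smul,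
          anti i h j l _ hhi hjl, anti i h a' l _ hhi (hgt hjl hl)]
    · by_cases hj' : j = a'
      · subst hj'
        simp only [liftModel_apply_right hlt.ne, liftModel_apply_of_ne (hlt.trans hjl).ne' hjl.ne',
          map_smul, anti i h j l _ hhi hjl]
      · by_cases hl : l = a
        · subst hl
          simp only [liftModel_apply_left, liftModel_apply_of_ne hj hj', map_add, map_smul,
            anti i h j l _ hhi hjl, anti i h j a' _ hhi (hjl.trans hlt)]
        · by_cases hl' : l = a'
          · subst hl'
            simp only [liftModel_apply_right hlt.ne, liftModel_apply_of_ne hj hj', map_smul,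
              anti i h j l _ hhi hjl]
          · simp only [liftModel_apply_of_ne hj hj', liftModel_apply_of_ne hl hl',
              anti i h j l _ hhi hjl]
  · intro i h j l hih hjl
    ext f d
    simp only [Module.End.mul_apply, LinearMap.smul_apply, LinearMap.add_apply, Pi.smul_apply,
      Pi.add_apply]
    by_cases hj : j = a
    · subst hj
      by_cases hl : l = a'
      · subst hl
        simp only [liftModel_apply_left, liftModel_apply_right hlt.ne, map_add, map_smul,
          diag i h j l _ hih hlt, col i h l _ hih]
        match_scalars <;> field_simp
        ring
      · simp only [liftModel_apply_left, liftModel_apply_of_ne hjl.ne' hl, map_add, map_smul,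
          diag i h j l _ hih hjl, diag i h a' l _ hih (hgt hjl hl)]
        module
    · by_cases hj' : j = a'
      · subst hj'
        simp only [liftModel_apply_right hlt.ne, liftModel_apply_of_ne (hlt.trans hjl).ne' hjl.ne',
          map_smul, diag i h j l _ hih hjl]
        module
      · by_cases hl : l = a
        · subst hl
          simp only [liftModel_apply_left, liftModel_apply_of_ne hj hj', map_add, map_smul,
            diag i h j l _ hih hjl, diag i h j a' _ hih (hjl.trans hlt)]
          module
        · by_cases hl' : l = a'
          · subst hl'
            simp only [liftModel_apply_right hlt.ne, liftModel_apply_of_ne hj hj', map_smul,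
              diag i h j l _ hih hjl]
            module
          · simp only [liftModel_apply_of_ne hj hj', liftModel_apply_of_ne hl hl',
              diag i h j l _ hih hjl]

end QMat

namespace QMat

open Finset

/-- The pointwise maximum of two index sets. -/
def piSup {m n : ℕ} (J K : Fin m ↪o Fin n) : Fin m ↪o Fin n :=
  OrderEmbedding.ofStrictMono (fun i => max (J i) (K i)) fun _ _ h =>
    max_lt_max (J.strictMono h) (K.strictMono h)

theorem piSup_apply {m n : ℕ} (J K : Fin m ↪o Fin n) (i : Fin m) :
    piSup J K i = max (J i) (K i) := rfl

theorem piSup_eq_left {m n : ℕ} {J K : Fin m ↪o Fin n} (h : K ≤ J) : piSup J K = J := by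
  ext i : 1
  exact max_eq_left (h i)

variable {k : Type*} [Field k] {m n : ℕ} {V : Type*} [AddCommGroup V] [Module k V]

/-- On functions supported in degrees `≤ d + r`, the value of `P` in degree `d` is, up to a nonzero
scalar, given by `Q` applied to the value in degree `d + r`. -/
def HasLead (P : Module.End k (ℕ → V)) (r : ℕ) (Q : Module.End k V) : Prop :=
  ∀ d, ∃ c : k, c ≠ 0 ∧ ∀ f : ℕ → V, (∀ e, d + r < e → f e = 0) → P f d = c • Q (f (d + r))

theorem hasLead_one : HasLead (1 : Module.End k (ℕ → V)) 0 1 := fun d =>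
  ⟨1, one_ne_zero, fun f _ => by simp⟩

theorem HasLead.mul {P P' : Module.End k (ℕ → V)} {r r' : ℕ} {Q Q' : Module.End k V}
    (h : HasLead P r Q) (h' : HasLead P' r' Q') : HasLead (P * P') (r + r') (Q * Q') := by
  intro d
  obtain ⟨c, hc, hP⟩ := h d
  obtain ⟨c', hc', hP'⟩ := h' (d + r)
  refine ⟨c * c', mul_ne_zero hc hc', fun f hf => ?_⟩
  rw [Module.End.mul_apply, hP, hP', ← add_assoc, map_smul, smul_smul, Module.End.mul_apply]
  · intro e he
    exact hf e (by omega)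
  · intro e he
    obtain ⟨c'', -, hP''⟩ := h' e
    rw [hP'' f fun e' he' => hf e' (by omega), hf _ (by omega), map_zero, smul_zero]

theorem HasLead.list_prod {ι : Type*} {P : ι → Module.End k (ℕ → V)} {r : ι → ℕ}
    {Q : ι → Module.End k V} {l : List ι} (h : ∀ i ∈ l, HasLead (P i) (r i) (Q i)) :
    HasLead (l.map P).prod (l.map r).sum (l.map Q).prod := by
  induction l with
  | nil => exact hasLead_one
  | cons i l ih =>
    simp only [List.map_cons, List.prod_cons, List.sum_cons]
    exact (h i List.mem_cons_self).mul (ih fun j hj => h j (List.mem_cons_of_mem _ hj))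

variable {q : k} {a a' : Fin n} {x : Fin m → Fin n → Module.End k V}

theorem liftModel_prod_apply_of_eventually_zero (l : List (Fin m × Fin n)) (f : ℕ → V) (d : ℕ)
    (hf : ∀ e, d < e → f e = 0) :
    (l.map fun p => liftModel q a a' x p.1 p.2).prod f d =
      (l.map fun p => liftWeight q a a' p.2).prod ^ d • (l.map fun p => x p.1 p.2).prod (f d) := by
  induction l generalizing d with
  | nil => simp
  | cons p l ih =>
    simp only [List.map_cons, List.prod_cons, Module.End.mul_apply, liftModel_apply]
    rw [ih d hf, ih (d + 1) fun e he => hf e (by omega), hf (d + 1) (by omega)]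
    simp [mul_pow, smul_smul]

theorem hasLead_qMinor_liftModel (hq : q ≠ 0) (J : Fin m ↪o Fin n) :
    HasLead (qMinor q (liftModel q a a' x) J) 0 (qMinor q x J) := by
  intro d
  refine ⟨(∏ i, liftWeight q a a' (J i)) ^ d,
    pow_ne_zero _ (prod_ne_zero_iff.mpr fun i _ => ?_), fun f hf => ?_⟩
  · rw [liftWeight]
    split_ifs <;> simp [hq]
  · simp only [qMinor, LinearMap.sum_apply, Finset.sum_apply, smul_sum]
    refine sum_congr rfl fun σ _ => ?_
    have h1 := liftModel_prod_apply_of_eventually_zero (q := q) (a := a) (a' := a') (x := x)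
      (List.ofFn fun i => (i, J (σ i))) f d hf
    simp only [List.map_ofFn, Function.comp_def] at h1
    rw [LinearMap.smul_apply, Pi.smul_apply, h1, List.prod_ofFn,
      Equiv.prod_comp σ fun i => liftWeight q a a' (J i), smul_comm]
    simp

theorem liftModel_prod_apply_of_count_eq_zero (l : List (Fin m × Fin n))
    (ha : (l.map Prod.snd).count a = 0) (ha' : a' ∉ l.map Prod.snd) (f : ℕ → V) (d : ℕ) :
    (l.map fun p => liftModel q a a' x p.1 p.2).prod f d =
      (l.map fun p => x p.1 p.2).prod (f d) := by
  induction l with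
  | nil => simp
  | cons p l ih =>
    simp only [List.map_cons, List.mem_cons, not_or] at ha ha'
    rw [List.count_eq_zero, List.mem_cons, not_or] at ha
    simp only [List.map_cons, List.prod_cons, Module.End.mul_apply,
      liftModel_apply_of_ne (Ne.symm ha.1) (Ne.symm ha'.1)]
    rw [ih (List.count_eq_zero.mpr ha.2) ha'.2]

theorem liftModel_prod_apply_of_count_eq_one (l : List (Fin m × Fin n))
    (ha : (l.map Prod.snd).count a = 1) (ha' : a' ∉ l.map Prod.snd) (f : ℕ → V) (d : ℕ) :
    (l.map fun p => liftModel q a a' x p.1 p.2).prod f d =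
      (q ^ d)⁻¹ • (l.map fun p => x p.1 p.2).prod (f d) +
        (l.map fun p => x p.1 (if p.2 = a then a' else p.2)).prod (f (d + 1)) := by
  induction l with
  | nil => simp at ha
  | cons p l ih =>
    simp only [List.map_cons, List.mem_cons, not_or] at ha ha'
    by_cases hp : p.2 = a
    · rw [hp, List.count_cons_self, Nat.add_eq_right] at ha
      have hmap : (l.map fun p => x p.1 (if p.2 = a then a' else p.2)) =
          l.map fun p => x p.1 p.2 := by
        refine List.map_congr_left fun p' hp' => ?_
        rw [if_neg]
        rintro h
        exact List.count_eq_zero.mp ha (h ▸ List.mem_map_of_mem hp')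
      simp only [List.map_cons, List.prod_cons, Module.End.mul_apply, hp, if_true, hmap,
        liftModel_apply_left, liftModel_prod_apply_of_count_eq_zero l ha ha'.2]
    · rw [List.count_cons_of_ne hp] at ha
      simp only [List.map_cons, List.prod_cons, Module.End.mul_apply, if_neg hp,
        liftModel_apply_of_ne hp (Ne.symm ha'.1), ih ha ha'.2, map_add, map_smul]

theorem qMinor_liftModel_apply {J K : Fin m ↪o Fin n} (ha : ∃ i, J i = a) (ha' : ∀ i, J i ≠ a')
    (hK : ∀ i, K i = if J i = a then a' else J i) (f : ℕ → V) (d : ℕ) :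
    qMinor q (liftModel q a a' x) J f d =
      (q ^ d)⁻¹ • qMinor q x J (f d) + qMinor q x K (f (d + 1)) := by
  simp only [qMinor, LinearMap.sum_apply, Finset.sum_apply, smul_sum, ← sum_add_distrib]
  refine sum_congr rfl fun σ _ => ?_
  have hcount : ((List.ofFn fun i => (i, J (σ i))).map Prod.snd).count a = 1 := by
    rw [List.map_ofFn]
    apply List.count_eq_one_of_mem
    · rw [List.nodup_ofFn]
      exact J.injective.comp σ.injective
    · obtain ⟨i, hi⟩ := ha
      rw [List.mem_ofFn]
      exact ⟨σ.symm i, by simpa using hi⟩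
  have hmem : a' ∉ (List.ofFn fun i => (i, J (σ i))).map Prod.snd := by
    rw [List.map_ofFn, List.mem_ofFn]
    rintro ⟨i, hi⟩
    exact ha' _ hi
  have h1 := liftModel_prod_apply_of_count_eq_one (q := q) (x := x) _ hcount hmem f d
  simp only [List.map_ofFn, Function.comp_def, ← hK] at h1
  rw [LinearMap.smul_apply, Pi.smul_apply, h1, smul_add, LinearMap.smul_apply,
    LinearMap.smul_apply, smul_comm]

end QMat

namespace QMat

open Finset

universe u

theorem exists_cover {m n : ℕ} {γ J : Fin m ↪o Fin n} (h : γ < J) :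
    ∃ (γ' : Fin m ↪o Fin n) (p : Fin m), (γ' p : ℕ) = γ p + 1 ∧ ∀ i, i ≠ p → γ' i = γ i := by
  have hne : (univ.filter fun i => γ i < J i).Nonempty := by
    by_contra! hempty
    rw [filter_eq_empty_iff] at hempty
    exact h.not_ge fun i => not_lt.mp (hempty (mem_univ i))
  set p := (univ.filter fun i => γ i < J i).max' hne with hp
  have hpJ : γ p < J p := (mem_filter.mp (max'_mem _ hne)).2
  have hpn : (γ p : ℕ) + 1 < n := (Nat.succ_le_of_lt (Fin.lt_def.mp hpJ)).trans_lt (J p).isLt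
  have hgt : ∀ i, p < i → (γ p : ℕ) + 1 < γ i := by
    intro i hi
    have h1 : γ i = J i := by
      refine le_antisymm (h.le i) (not_lt.mp fun hlt => ?_)
      exact (le_max' (univ.filter fun i => γ i < J i) i
        (mem_filter.mpr ⟨mem_univ _, hlt⟩)).not_gt hi
    have h2 := Fin.lt_def.mp (J.strictMono hi)
    have h3 := Fin.lt_def.mp hpJ
    rw [h1]
    omega
  have hmono : StrictMono (Function.update γ p ⟨γ p + 1, hpn⟩) := by
    intro i j hij
    rcases eq_or_ne i p with rfl | hi
    · rw [Function.update_self, Function.update_of_ne hij.ne']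
      exact hgt j hij
    · rw [Function.update_of_ne hi]
      rcases eq_or_ne j p with rfl | hj
      · rw [Function.update_self, Fin.lt_def]
        exact (Fin.lt_def.mp (γ.strictMono hij)).trans (Nat.lt_succ_self _)
      · rw [Function.update_of_ne hj]
        exact γ.strictMono hij
  refine ⟨OrderEmbedding.ofStrictMono _ hmono, p, ?_, fun i hi => ?_⟩
  · simp
  · simp [hi]

section

variable {m n : ℕ} {γ γ' : Fin m ↪o Fin n} {p : Fin m}

theorem lt_of_cover (hp : (γ' p : ℕ) = γ p + 1) (hne : ∀ i, i ≠ p → γ' i = γ i) : γ < γ' := by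
  refine lt_of_le_of_ne (pi_le_iff.mpr fun i => ?_) fun h => ?_
  · rcases eq_or_ne i p with rfl | hi
    · exact Fin.le_def.mpr (by omega)
    · exact (hne i hi).ge
  · rw [h] at hp
    omega

theorem apply_eq_of_not_ge_cover (hp : (γ' p : ℕ) = γ p + 1) (hne : ∀ i, i ≠ p → γ' i = γ i)
    {J : Fin m ↪o Fin n} (hJ : γ ≤ J) (hJ' : ¬ γ' ≤ J) : J p = γ p := by
  by_contra h
  refine hJ' (pi_le_iff.mpr fun i => ?_)
  rcases eq_or_ne i p with rfl | hi
  · have h1 := Fin.le_def.mp (pi_le_iff.mp hJ i)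
    have h2 := Fin.val_ne_of_ne h
    exact Fin.le_def.mpr (by omega)
  · exact (hne i hi).trans_le (hJ i)

theorem piSup_cover_apply (hp : (γ' p : ℕ) = γ p + 1) (hne : ∀ i, i ≠ p → γ' i = γ i)
    {J : Fin m ↪o Fin n} (hJ : γ ≤ J) (hJ' : ¬ γ' ≤ J) (i : Fin m) :
    piSup J γ' i = if J i = γ p then γ' p else J i := by
  have hJp := apply_eq_of_not_ge_cover hp hne hJ hJ'
  rw [piSup_apply]
  rcases eq_or_ne i p with rfl | hi
  · rw [if_pos hJp, hJp, max_eq_right]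
    exact Fin.le_def.mpr (by omega)
  · rw [if_neg fun h => hi (J.injective (h.trans hJp.symm)), hne i hi, max_eq_left (hJ i)]

theorem apply_ne_of_not_ge_cover (hp : (γ' p : ℕ) = γ p + 1) (hne : ∀ i, i ≠ p → γ' i = γ i)
    {J : Fin m ↪o Fin n} (hJ : γ ≤ J) (hJ' : ¬ γ' ≤ J) (i : Fin m) : J i ≠ γ' p := by
  intro h
  have hJp := apply_eq_of_not_ge_cover hp hne hJ hJ'
  rcases lt_trichotomy i p with hi | rfl | hi
  · have h1 := Fin.lt_def.mp (J.strictMono hi)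
    rw [h, hJp] at h1
    omega
  · rw [← h, hJp] at hp
    omega
  · have h1 := (γ'.strictMono hi).trans_le ((hne i hi.ne').trans_le (hJ i))
    exact h1.ne' h

theorem eq_of_piSup_eq (hp : (γ' p : ℕ) = γ p + 1) (hne : ∀ i, i ≠ p → γ' i = γ i)
    {J K : Fin m ↪o Fin n} (hJ : γ ≤ J) (hJ' : ¬ γ' ≤ J) (hK : γ ≤ K) (hK' : ¬ γ' ≤ K)
    (h : piSup J γ' = piSup K γ') : J = K := by
  ext i : 1
  rcases eq_or_ne i p with rfl | hi
  · rw [apply_eq_of_not_ge_cover hp hne hJ hJ', apply_eq_of_not_ge_cover hp hne hK hK']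
  · have := congrArg (fun L => L i) h
    simpa only [piSup_apply, hne i hi, max_eq_left (hJ i), max_eq_left (hK i)] using this

open Classical in
/-- The number of factors of a monomial that are not above `γ'` in the poset. -/
noncomputable def defect (γ' : Fin m ↪o Fin n) (l : List (Fin m ↪o Fin n)) : ℕ :=
  (l.map fun J => if γ' ≤ J then 0 else 1).sum

theorem defect_eq_zero {l : List (Fin m ↪o Fin n)} (h : ∀ J ∈ l, γ' ≤ J) : defect γ' l = 0 := by
  rw [defect, List.sum_eq_zero_iff_forall_eq_nat]
  intro d hd
  obtain ⟨J, hJ, rfl⟩ := List.mem_map.mp hd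
  exact if_pos (h J hJ)

theorem eq_of_defect_eq (hp : (γ' p : ℕ) = γ p + 1) (hne : ∀ i, i ≠ p → γ' i = γ i)
    {l l' : List (Fin m ↪o Fin n)} (hl : l.Pairwise (· ≤ ·)) (hl' : l'.Pairwise (· ≤ ·))
    (hγl : ∀ J ∈ l, γ ≤ J) (hγl' : ∀ J ∈ l', γ ≤ J) (hd : defect γ' l = defect γ' l')
    (hm : l.map (piSup · γ') = l'.map (piSup · γ')) : l = l' := by
  induction l generalizing l' with
  | nil => simpa using hm.symm
  | cons J l ih =>
    obtain _ | ⟨K, l'⟩ := l'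
    · simp at hm
    have hzero : ∀ {J : Fin m ↪o Fin n} {l : List (Fin m ↪o Fin n)},
        (J :: l).Pairwise (· ≤ ·) → γ' ≤ J → defect γ' (J :: l) = 0 := by
      intro J l hl hJ
      refine defect_eq_zero fun L hL => ?_
      rcases List.mem_cons.mp hL with rfl | hL
      · exact hJ
      · exact hJ.trans (List.rel_of_pairwise_cons hl hL)
    have hpos : ∀ {J : Fin m ↪o Fin n} {l : List (Fin m ↪o Fin n)}, ¬ γ' ≤ J →
        defect γ' (J :: l) = 1 + defect γ' l := by
      intro J l hJ
      simp [defect, hJ]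
    have hiff : γ' ≤ J ↔ γ' ≤ K := by
      constructor
      · intro h
        by_contra hK
        rw [hzero hl h, hpos hK] at hd
        omega
      · intro h
        by_contra hJ
        rw [hzero hl' h, hpos hJ] at hd
        omega
    simp only [List.map_cons, List.cons.injEq] at hm
    have hdl : defect γ' l = defect γ' l' := by
      by_cases hJ : γ' ≤ J
      · have h1 := hzero hl hJ
        have h2 := hzero hl' (hiff.mp hJ)
        simp only [defect, List.map_cons, List.sum_cons] at h1 h2 ⊢
        omega
      · rw [hpos hJ, hpos (mt hiff.mpr hJ)] at hd
        omega
    have hJK : J = K := by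
      by_cases hJ : γ' ≤ J
      · rw [← piSup_eq_left hJ, ← piSup_eq_left (hiff.mp hJ), hm.1]
      · exact eq_of_piSup_eq hp hne (hγl J List.mem_cons_self) hJ (hγl' K List.mem_cons_self)
          (mt hiff.mpr hJ) hm.1
    rw [hJK, ih hl.of_cons hl'.of_cons (fun L hL => hγl L (List.mem_cons_of_mem _ hL))
      (fun L hL => hγl' L (List.mem_cons_of_mem _ hL)) hdl hm.2]

/-- Taking the supremum with `γ'` of every factor of a standard monomial. -/
def StdList.sup (γ' : Fin m ↪o Fin n) (l : StdList γ) : StdList γ' :=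
  ⟨l.1.map (piSup · γ'), l.2.1.map _ fun _ _ h _ => max_le_max (h _) le_rfl, by
    intro J hJ
    obtain ⟨K, -, rfl⟩ := List.mem_map.mp hJ
    exact fun i => le_max_right _ _⟩

variable {k : Type*} [Field k] {V : Type*} [AddCommGroup V] [Module k V] {q : k}
  {x : Fin m → Fin n → Module.End k V}

theorem IsModel.lift (hx : IsModel q γ' x) (hq : q ≠ 0) (hp : (γ' p : ℕ) = γ p + 1)
    (hne : ∀ i, i ≠ p → γ' i = γ i) : IsModel q γ (liftModel q (γ p) (γ' p) x) := by
  classical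
  have hle : γ ≤ γ' := (lt_of_cover hp hne).le
  refine ⟨hx.isQMat.liftModel hq hp, ?_, ?_⟩
  · intro i j hj
    ext f d
    rw [liftModel_apply, hx.zero i j (hj.trans_le (hle i))]
    by_cases h : j = γ p
    · subst h
      have hpi : p < i := γ.lt_iff_lt.mp hj
      simp [hx.zero i (γ' p) (γ'.strictMono hpi)]
    · simp [h]
  · have hlead : ∀ l : StdList γ, HasLead (l.1.map (qMinor q (liftModel q (γ p) (γ' p) x))).prod
        (defect γ' l.1) ((StdList.sup γ' l).1.map (qMinor q x)).prod := by
      intro l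
      rw [StdList.sup, List.map_map]
      refine HasLead.list_prod fun J hJ => ?_
      have hγJ := l.2.2 J hJ
      by_cases h : γ' ≤ J
      · rw [if_pos h, Function.comp_apply, piSup_eq_left h]
        exact hasLead_qMinor_liftModel hq J
      · rw [if_neg h, Function.comp_apply]
        refine fun d => ⟨1, one_ne_zero, fun f hf => ?_⟩
        rw [qMinor_liftModel_apply ⟨p, apply_eq_of_not_ge_cover hp hne hγJ h⟩
          (apply_ne_of_not_ge_cover hp hne hγJ h) (piSup_cover_apply hp hne hγJ h),
          qMinor_eq_zero_of_zero hx.zero h]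
        simp
    rw [linearIndependent_iff']
    intro s c hc
    suffices ∀ r, ∀ l ∈ s, defect γ' l.1 = r → c l = 0 from fun l hl => this _ l hl rfl
    intro r
    induction r using Nat.strong_induction_on with
    | _ r ih =>
    choose e he0 he using fun l => hlead l 0
    simp only [zero_add] at he
    have hinj : Function.Injective fun l : {l : StdList γ // defect γ' l.1 = r} =>
        StdList.sup γ' l.1 := by
      intro l l' h
      exact Subtype.ext (Subtype.ext (eq_of_defect_eq hp hne l.1.2.1 l'.1.2.1 l.1.2.2 l'.1.2.2
        (l.2.trans l'.2.symm) (congrArg Subtype.val h)))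
    have hzero : ∑ l ∈ s.subtype fun l => defect γ' l.1 = r, (c l.1 * e l.1) •
        ((StdList.sup γ' l.1).1.map (qMinor q x)).prod = 0 := by
      rw [sum_subtype_eq_sum_filter
        (fun l => (c l * e l) • ((StdList.sup γ' l).1.map (qMinor q x)).prod)]
      ext v
      have h0 := congrArg (fun T : Module.End k (ℕ → V) => T (Pi.single r v) 0) hc
      simp only [LinearMap.sum_apply, Finset.sum_apply, LinearMap.smul_apply, Pi.smul_apply,
        LinearMap.zero_apply, Pi.zero_apply] at h0
      rw [LinearMap.sum_apply, LinearMap.zero_apply, ← h0, sum_filter]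
      refine sum_congr rfl fun l hl => ?_
      rcases lt_trichotomy (defect γ' l.1) r with h | h | h
      · rw [if_neg h.ne, ih _ h l hl rfl, zero_smul]
      · rw [if_pos h, he]
        · rw [h, Pi.single_eq_same, LinearMap.smul_apply, smul_smul]
        · intro d hd
          exact Pi.single_eq_of_ne (by omega) _
      · rw [if_neg h.ne', he]
        · rw [Pi.single_eq_of_ne h.ne', map_zero, smul_zero, smul_zero]
        · intro d hd
          exact Pi.single_eq_of_ne (by omega) _
    intro l hl hlr
    have := linearIndependent_iff'.mp (hx.indep.comp _ hinj) _ _ hzero ⟨l, hlr⟩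
      (mem_subtype.mpr hl)
    exact (mul_eq_zero.mp this).resolve_right (he0 l)

end

theorem exists_isModel {k : Type u} [Field k] {q : k} (hq : q ≠ 0) {m n : ℕ} (hm : 0 < m)
    (γ : Fin m ↪o Fin n) :
    ∃ (V : Type u) (_ : AddCommGroup V) (_ : Module k V) (x : Fin m → Fin n → Module.End k V),
      IsModel q γ x := by
  induction γ using WellFoundedGT.induction with
  | _ γ ih =>
  by_cases hγ : ∀ J, γ ≤ J → J = γ
  · exact ⟨_, _, _, _, isModel_topModel q hm hγ⟩
  · push Not at hγ
    obtain ⟨J, hJ, hne⟩ := hγ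
    obtain ⟨γ', p, hp, hne⟩ := exists_cover (lt_of_le_of_ne hJ hne.symm)
    obtain ⟨V, _, _, x, hx⟩ := ih γ' (lt_of_cover hp hne)
    exact ⟨_, _, _, _, hx.lift hq hp hne⟩

end QMat

namespace QMat

universe u

open Finset

section QuantumMat

variable {k : Type u} [Field k] {q : k} (hq : q ≠ 0) {m n : ℕ}

theorem isQMat_qX : IsQMat q (qX k (Units.mk0 q hq) (m := m) (n := n)) where
  row i j l h := by
    simpa [qX] using RingQuot.mkAlgHom_rel k (qMatrixRel.row (u := Units.mk0 q hq) i j l h)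
  col i h j hih := by
    simpa [qX] using RingQuot.mkAlgHom_rel k (qMatrixRel.col (u := Units.mk0 q hq) i h j hih)
  anti i h j l hhi hjl := by
    simpa [qX] using
      RingQuot.mkAlgHom_rel k (qMatrixRel.antidiag (u := Units.mk0 q hq) i h j l hhi hjl)
  diag i h j l hih hjl := by
    simpa [qX] using
      RingQuot.mkAlgHom_rel k (qMatrixRel.diag (u := Units.mk0 q hq) i h j l hih hjl)

theorem qMaximalMinor_eq (J : Fin m ↪o Fin n) :
    qMaximalMinor k (Units.mk0 q hq) J = qMinor q (qX k (Units.mk0 q hq)) J := rfl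

variable {R : Type*} [Ring R] [Algebra k R] {x : Fin m → Fin n → R}

/-- The algebra map out of the generic quantum matrix algebra given by a quantum matrix. -/
noncomputable def IsQMat.toAlgHom (hx : IsQMat q x) :
    QuantumMat k (Units.mk0 q hq) m n →ₐ[k] R :=
  RingQuot.liftAlgHom k ⟨FreeAlgebra.lift k fun p => x p.1 p.2, by
    intro a b h
    cases h with
    | row i j l h => simpa using hx.row i j l h
    | col i h j hih => simpa using hx.col i h j hih
    | antidiag i h j l hhi hjl => simpa using hx.anti i h j l hhi hjl
    | diag i h j l hih hjl => simpa using hx.diag i h j l hih hjl⟩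

theorem IsQMat.toAlgHom_qX (hx : IsQMat q x) (i : Fin m) (j : Fin n) :
    hx.toAlgHom hq (qX k (Units.mk0 q hq) i j) = x i j := by
  simp [toAlgHom, qX]

theorem IsQMat.toAlgHom_qMaximalMinor (hx : IsQMat q x) (J : Fin m ↪o Fin n) :
    hx.toAlgHom hq (qMaximalMinor k (Units.mk0 q hq) J) = qMinor q x J := by
  simp only [qMaximalMinor_eq, qMinor, map_sum, map_smul, map_list_prod, List.map_ofFn,
    Function.comp_def, hx.toAlgHom_qX]

/-- The restriction of `IsQMat.toAlgHom` to the quantum grassmannian. -/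
noncomputable def IsQMat.grHom (hx : IsQMat q x) :
    QuantumGrassmannian k (Units.mk0 q hq) m n →ₐ[k] R :=
  (hx.toAlgHom hq).comp (Subalgebra.val _)

theorem IsQMat.grHom_grMinor (hx : IsQMat q x) (J : Fin m ↪o Fin n) :
    hx.grHom hq (grMinor k (Units.mk0 q hq) J) = qMinor q x J :=
  hx.toAlgHom_qMaximalMinor hq J

end QuantumMat

section Straightening

variable {k : Type u} [Field k] {q : k} (hq : q ≠ 0) {m n : ℕ}

local notation "gr" => grMinor k (Units.mk0 q hq)

theorem grMinor_mul_mem_span (I J : Fin m ↪o Fin n) :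
    gr I * gr J ∈ Submodule.span k
      (Set.range fun p : {p : (Fin m ↪o Fin n) × (Fin m ↪o Fin n) // p.1 ≤ p.2} =>
        gr p.1.1 * gr p.1.2) := by
  have h := (isQMat_qX hq).qMinor_mul_mem_span_standard hq I J
  let f := (Subalgebra.val (QuantumGrassmannian k (Units.mk0 q hq) m n)).toLinearMap
  have h' : f (gr I * gr J) ∈ (Submodule.span k
      (Set.range fun p : {p : (Fin m ↪o Fin n) × (Fin m ↪o Fin n) // p.1 ≤ p.2} =>
        gr p.1.1 * gr p.1.2)).map f := by
    rw [Submodule.map_span]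
    refine Submodule.span_mono ?_ h
    rintro _ ⟨K, L, hKL, rfl⟩
    exact ⟨_, ⟨⟨(K, L), hKL⟩, rfl⟩, rfl⟩
  obtain ⟨y, hy, hfy⟩ := h'
  have hyg : y = gr I * gr J := Subtype.ext hfy
  rwa [← hyg]

/-- If a combination of standard monomials of degree two is killed by models attached to all the
elements of the poset that violate `S`, then only leading factors satisfying `S` occur in it. -/
theorem mem_span_of_models {S : (Fin m ↪o Fin n) → Prop}
    {z : QuantumGrassmannian k (Units.mk0 q hq) m n}
    (hz : z ∈ Submodule.span k
      (Set.range fun p : {p : (Fin m ↪o Fin n) × (Fin m ↪o Fin n) // p.1 ≤ p.2} =>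
        gr p.1.1 * gr p.1.2))
    (hS : ∀ K, ¬ S K → ∃ (V : Type u) (_ : AddCommGroup V) (_ : Module k V)
      (x : Fin m → Fin n → Module.End k V) (hx : IsModel q K x), hx.isQMat.grHom hq z = 0) :
    z ∈ Submodule.span k {y | ∃ K L, K ≤ L ∧ S K ∧ y = gr K * gr L} := by
  classical
  have := Fintype.ofFinite {p : (Fin m ↪o Fin n) × (Fin m ↪o Fin n) // p.1 ≤ p.2}
  obtain ⟨c, rfl⟩ := (Submodule.mem_span_range_iff_exists_fun k).mp hz
  refine Submodule.sum_mem _ fun p _ => ?_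
  by_cases hp : S p.1.1
  · exact Submodule.smul_mem _ _ (Submodule.subset_span ⟨_, _, p.2, hp, rfl⟩)
  obtain ⟨V, _, _, x, hx, hzero⟩ := hS _ hp
  simp only [map_sum, map_smul, map_mul, IsQMat.grHom_grMinor] at hzero
  let f : {r : {p : (Fin m ↪o Fin n) × (Fin m ↪o Fin n) // p.1 ≤ p.2} // p.1.1 ≤ r.1.1} →
      StdList p.1.1 := fun r => ⟨[r.1.1.1, r.1.1.2], by simpa using r.1.2,
        by simpa using ⟨r.2, r.2.trans r.1.2⟩⟩
  have hf : Function.Injective f := by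
    intro r s h
    have := congrArg Subtype.val h
    simp only [f, List.cons.injEq, and_true] at this
    exact Subtype.ext (Subtype.ext (Prod.ext this.1 this.2))
  have hsum : ∑ r ∈ univ.subtype fun r : {p : (Fin m ↪o Fin n) × (Fin m ↪o Fin n) // p.1 ≤ p.2} =>
      p.1.1 ≤ r.1.1, c r.1 • ((f r).1.map (qMinor q x)).prod = 0 := by
    simp only [f, List.map_cons, List.map_nil, List.prod_cons, List.prod_nil, mul_one]
    rw [sum_subtype_eq_sum_filter (fun r => c r • (qMinor q x r.1.1 * qMinor q x r.1.2)),
      ← hzero]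
    refine sum_subset (filter_subset _ _) fun r _ hr => ?_
    rw [mem_filter, not_and] at hr
    rw [qMinor_eq_zero_of_zero hx.zero (hr (mem_univ _)), zero_mul, smul_zero]
  have := linearIndependent_iff'.mp (hx.indep.comp f hf) _ _ hsum ⟨p, le_rfl⟩ (by simp)
  rw [this, zero_smul]
  exact zero_mem _

theorem grMinor_straighten (hm : 0 < m) {I J : Fin m ↪o Fin n} (hIJ : ¬ I ≤ J) (hJI : ¬ J ≤ I) :
    gr I * gr J ∈ Submodule.span k {y | ∃ K L, K ≤ L ∧ (K < I ∧ K < J) ∧ y = gr K * gr L} := by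
  refine mem_span_of_models hq (grMinor_mul_mem_span hq I J) fun K hK => ?_
  obtain ⟨V, _, _, x, hx⟩ := exists_isModel hq hm K
  refine ⟨V, _, _, x, hx, ?_⟩
  have : ¬ K ≤ I ∨ ¬ K ≤ J := by
    by_contra! h
    exact hK ⟨lt_of_le_of_ne h.1 fun e => hIJ (e ▸ h.2), lt_of_le_of_ne h.2 fun e => hJI (e ▸ h.1)⟩
  simp only [map_mul, IsQMat.grHom_grMinor]
  rcases this with h | h <;> simp [qMinor_eq_zero_of_zero hx.zero h]

theorem grMinor_comm_of_le (hm : 0 < m) {I J : Fin m ↪o Fin n} (hIJ : I ≤ J) :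
    ∃ c : k, c ≠ 0 ∧ gr I * gr J + c • (gr J * gr I) ∈
      Submodule.span k {y | ∃ K L, K ≤ L ∧ (K < I ∧ K < J) ∧ y = gr K * gr L} := by
  obtain ⟨V, _, _, x, hx⟩ := exists_isModel hq hm I
  obtain ⟨c, hc, h⟩ := hx.isQMat.qMinor_self_mul_comm hq hx.zero J
  refine ⟨-c, neg_ne_zero.mpr hc, mem_span_of_models hq (add_mem (grMinor_mul_mem_span hq I J)
    (Submodule.smul_mem _ _ (grMinor_mul_mem_span hq J I))) fun K hK => ?_⟩
  by_cases hKI : K = I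
  · subst hKI
    refine ⟨V, _, _, x, hx, ?_⟩
    simp only [map_add, map_smul, map_mul, IsQMat.grHom_grMinor]
    rw [h, neg_smul, add_neg_cancel]
  obtain ⟨V, _, _, x, hx⟩ := exists_isModel hq hm K
  refine ⟨V, _, _, x, hx, ?_⟩
  have : ¬ K ≤ I := fun h =>
    hK ⟨lt_of_le_of_ne h hKI, (lt_of_le_of_ne h hKI).trans_le hIJ⟩
  simp only [map_add, map_smul, map_mul, IsQMat.grHom_grMinor]
  simp [qMinor_eq_zero_of_zero hx.zero this]

theorem grMinor_comm (hm : 0 < m) (I J : Fin m ↪o Fin n) :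
    ∃ c : k, c ≠ 0 ∧ gr I * gr J + c • (gr J * gr I) ∈
      Submodule.span k {y | ∃ K L, K ≤ L ∧ (K < I ∧ K < J) ∧ y = gr K * gr L} := by
  by_cases hIJ : I ≤ J
  · exact grMinor_comm_of_le hq hm hIJ
  by_cases hJI : J ≤ I
  · obtain ⟨c, hc, h⟩ := grMinor_comm_of_le hq hm hJI
    refine ⟨c⁻¹, inv_ne_zero hc, ?_⟩
    have := Submodule.smul_mem _ c⁻¹ h
    rw [smul_add, smul_smul, inv_mul_cancel₀ hc, one_smul, add_comm] at this
    simpa only [and_comm (a := _ < J)] using this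
  · refine ⟨1, one_ne_zero, add_mem (grMinor_straighten hq hm hIJ hJI)
      (Submodule.smul_mem _ _ ?_)⟩
    simpa only [and_comm (a := _ < J)] using grMinor_straighten hq hm hJI hIJ

end Straightening

end QMat

namespace QMat

open Finset Polynomial

variable {k : Type*} [Field k]

theorem exists_lift_of_ker_eq_span {A B C : Type*} [Ring A] [Algebra k A] [Ring B] [Algebra k B]
    [Ring C] [Algebra k C] (p : A →ₐ[k] B) (hsurj : Function.Surjective p) {s : Set A}
    (hker : (RingHom.ker (p : A →+* B) : Set A) = (TwoSidedIdeal.span s : Set A))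
    (g : A →ₐ[k] C) (hg : ∀ a ∈ s, g a = 0) : ∃ ψ : B →ₐ[k] C, ∀ a, ψ (p a) = g a := by
  have hle : RingHom.ker (p : A →+* B) ≤ RingHom.ker (g : A →+* C) := by
    intro a ha
    have ha' : a ∈ TwoSidedIdeal.span s := by
      rw [← SetLike.mem_coe, ← hker]
      exact ha
    have hspan : TwoSidedIdeal.span s ≤ TwoSidedIdeal.ker g :=
      TwoSidedIdeal.span_le.mpr fun b hb => (TwoSidedIdeal.mem_ker g).mpr (hg b hb)
    exact (TwoSidedIdeal.mem_ker g).mp (hspan ha')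
  have hψ : ∀ a, (p : A →+* B).liftOfSurjective hsurj ⟨g, hle⟩ (p a) = g a :=
    RingHom.liftOfSurjective_comp_apply (p : A →+* B) hsurj ⟨(g : A →+* C), hle⟩
  refine ⟨{ (p : A →+* B).liftOfSurjective hsurj ⟨g, hle⟩ with commutes' := fun r => ?_ }, hψ⟩
  have := hψ (algebraMap k A r)
  rw [p.commutes, g.commutes] at this
  exact this

/-- A coaction of the polynomial bialgebra under which a generating set is homogeneous of degree
one defines a grading. -/
theorem exists_gradedAlgebra {B : Type*} [Ring B] [Algebra k B] (D : B →ₐ[k] B[X]) {s : Set B}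
    (hs : Algebra.adjoin k s = ⊤) (hD : ∀ b ∈ s, D b = monomial 1 b) :
    ∃ 𝒜 : ℕ → Submodule k B, Nonempty (GradedAlgebra 𝒜) ∧ ∀ b ∈ s, b ∈ 𝒜 1 := by
  classical
  let 𝒜 : ℕ → Submodule k B := fun d =>
    LinearMap.eqLocus D.toLinearMap ((monomial d).restrictScalars k)
  have hmem : ∀ {d b}, b ∈ 𝒜 d ↔ D b = monomial d b := Iff.rfl
  have : SetLike.GradedMonoid 𝒜 :=
    { one_mem := by
        rw [hmem, map_one, monomial_zero_one]
      mul_mem := by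
        intro i j a b ha hb
        rw [hmem] at *
        rw [map_mul, ha, hb, monomial_mul_monomial] }
  have hint : DirectSum.IsInternal 𝒜 := by
    constructor
    · rw [injective_iff_map_eq_zero]
      intro f hf
      ext d
      have hcoe : DirectSum.coeAddMonoidHom 𝒜 f = ∑ i ∈ f.support, (f i : B) :=
        DirectSum.coeAddMonoidHom_eq_dfinsuppSum _ _
      have h := congrArg (fun b => (D b).coeff d) (hcoe.symm.trans hf)
      simp only [map_sum, map_zero, coeff_zero, finsetSum_coeff] at h
      rw [sum_congr rfl fun i _ => by rw [hmem.mp (f i).2, coeff_monomial],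
        sum_ite_eq' ] at h
      by_cases hd : d ∈ f.support
      · simpa [hd] using h
      · simpa using hd
    · intro b
      have : b ∈ (DirectSum.coeAlgHom 𝒜).range := by
        have hle : Algebra.adjoin k s ≤ (DirectSum.coeAlgHom 𝒜).range := by
          rw [Algebra.adjoin_le_iff]
          intro a ha
          exact ⟨DirectSum.of (fun i => 𝒜 i) 1 ⟨a, hD a ha⟩, DirectSum.coeAlgHom_of _ _ _⟩
        exact hle (hs ▸ Algebra.mem_top)
      exact this
  exact ⟨𝒜, ⟨{ hint.chooseDecomposition with }⟩, hD⟩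

theorem exists_coaction_adjoin {U : Type*} [Ring U] [Algebra k U] (δ : U →ₐ[k] U[X]) (s : Set U)
    (hδ : ∀ b ∈ s, δ b = monomial 1 b) :
    ∃ D : Algebra.adjoin k s →ₐ[k] (Algebra.adjoin k s)[X],
      ∀ a : Algebra.adjoin k s, (a : U) ∈ s → D a = monomial 1 a := by
  let A := Algebra.adjoin k s
  let ι : A[X] →ₐ[k] U[X] := Polynomial.mapAlgHom A.val
  have hι : Function.Injective ι := Polynomial.map_injective _ Subtype.val_injective
  have hιm : ∀ (d : ℕ) (a : A), ι (monomial d a) = monomial d (a : U) := fun d a =>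
    Polynomial.map_monomial _
  have hrange : ∀ a : A, (δ.comp A.val) a ∈ ι.range := by
    have : A ≤ ι.range.comap δ := by
      refine Algebra.adjoin_le fun b hb => ?_
      exact ⟨monomial 1 ⟨b, Algebra.subset_adjoin hb⟩, (hιm _ _).trans (hδ b hb).symm⟩
    exact fun a => this a.2
  refine ⟨((AlgEquiv.ofInjective ι hι).symm : ι.range →ₐ[k] A[X]).comp
    ((δ.comp A.val).codRestrict ι.range hrange), fun a ha => ?_⟩
  apply hι
  rw [hιm, ← hδ _ ha]
  exact congrArg Subtype.val ((AlgEquiv.ofInjective ι hι).apply_symm_apply _)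

end QMat

namespace QMat

open Finset Polynomial

variable {k : Type*} [Field k] {q : k} {m n : ℕ}

theorem prod_ofFn_monomial {R : Type*} [Ring R] (e : Fin m → ℕ) (f : Fin m → R) :
    (List.ofFn fun i => monomial (e i) (f i)).prod = monomial (∑ i, e i) (List.ofFn f).prod := by
  induction m with
  | zero => simp
  | succ m ih =>
    rw [List.ofFn_succ, List.prod_cons, ih, monomial_mul_monomial, Fin.sum_univ_succ,
      List.ofFn_succ, List.prod_cons]

section Scaling

variable {R : Type*} [Ring R] [Algebra k R] {x : Fin m → Fin n → R}

theorem IsQMat.monomial (hx : IsQMat q x) (e : Fin m → ℕ) :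
    IsQMat q fun i j => Polynomial.monomial (e i) (x i j) where
  row i j l h := by
    simp only [monomial_mul_monomial, hx.row i j l h, smul_monomial]
  col i h j hih := by
    simp only [monomial_mul_monomial, hx.col i h j hih, smul_monomial, add_comm (e i)]
  anti i h j l hhi hjl := by
    simp only [monomial_mul_monomial, hx.anti i h j l hhi hjl, add_comm (e i)]
  diag i h j l hih hjl := by
    simp only [monomial_mul_monomial, hx.diag i h j l hih hjl, smul_monomial, add_comm (e h),
      map_add]

theorem qMinor_monomial (e : Fin m → ℕ) (J : Fin m ↪o Fin n) :
    qMinor q (fun i j => monomial (e i) (x i j)) J = monomial (∑ i, e i) (qMinor q x J) := by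
  simp only [qMinor, map_sum]
  refine sum_congr rfl fun σ _ => ?_
  rw [prod_ofFn_monomial e fun i => x i (J (σ i)), smul_monomial]

end Scaling

variable (hq : q ≠ 0)

theorem exists_coaction (hm : 0 < m) :
    ∃ D : QuantumGrassmannian k (Units.mk0 q hq) m n →ₐ[k]
        (QuantumGrassmannian k (Units.mk0 q hq) m n)[X],
      ∀ J, D (grMinor k (Units.mk0 q hq) J) = monomial 1 (grMinor k (Units.mk0 q hq) J) := by
  let e : Fin m → ℕ := Pi.single ⟨0, hm⟩ 1
  have he : ∑ i, e i = 1 := by simp [e]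
  obtain ⟨D, hD⟩ := exists_coaction_adjoin (((isQMat_qX hq).monomial e).toAlgHom hq)
    (Set.range fun J : Fin m ↪o Fin n => qMaximalMinor k (Units.mk0 q hq) J) (by
      rintro _ ⟨J, rfl⟩
      rw [IsQMat.toAlgHom_qMaximalMinor, qMinor_monomial, he]
      rfl)
  exact ⟨D, fun J => hD _ ⟨J, rfl⟩⟩

theorem adjoin_range_grMinor :
    Algebra.adjoin k (Set.range fun J : Fin m ↪o Fin n => grMinor k (Units.mk0 q hq) J) = ⊤ := by
  have h := Algebra.adjoin_adjoin_coe_preimage (R := k)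
    (s := Set.range fun J : Fin m ↪o Fin n => qMaximalMinor k (Units.mk0 q hq) J)
  refine Eq.trans (congrArg _ ?_) h
  ext a
  simp only [Set.mem_range]
  exact exists_congr fun J => Subtype.ext_iff

end QMat

/-- Let `k` be a field, `q ∈ k` nonzero and `m ≤ n` positive integers.
For `γ ∈ Π_{m,n}`, the quantum Schubert variety
`O_q(G_{m,n}(k))_γ = O_q(G_{m,n}(k))/⟨Ω_γ⟩`, where `Ω_γ = {π : π ≱st γ}` (modelled by any
surjective `k`-algebra map `p` out of the quantum grassmannian whose kernel is the two-sided
ideal generated by `Ω_γ`), is a quantum graded algebra with a straightening law on the poset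
`Π_{m,n} ∖ Ω_γ = {π : γ ≤st π}`, identified with its image under `p`. -/
theorem quantumSchubert_isQASL (k : Type*) [Field k] (q : k) (hq : q ≠ 0)
    (m n : ℕ) (hm : 0 < m) (hmn : m ≤ n) (γ : Fin m ↪o Fin n)
    (B : Type*) [Ring B] [Algebra k B]
    (p : QuantumGrassmannian k (Units.mk0 q hq) m n →ₐ[k] B)
    (hsurj : Function.Surjective p)
    (hker : (RingHom.ker (p : QuantumGrassmannian k (Units.mk0 q hq) m n →+* B) :
        Set (QuantumGrassmannian k (Units.mk0 q hq) m n)) =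
      (TwoSidedIdeal.span
        ((grMinor k (Units.mk0 q hq)) '' {π : Fin m ↪o Fin n | ¬ γ ≤ π}) :
        Set (QuantumGrassmannian k (Units.mk0 q hq) m n))) :
    ∃ (𝒜 : ℕ → Submodule k B)
      (Q : QuantumGradedASL k B 𝒜 {π : Fin m ↪o Fin n // γ ≤ π}),
      ∀ x : {π : Fin m ↪o Fin n // γ ≤ π},
        Q.elem x = p (grMinor k (Units.mk0 q hq) (x : Fin m ↪o Fin n)) := by
  let Ω := grMinor k (Units.mk0 q hq) '' {π : Fin m ↪o Fin n | ¬ γ ≤ π}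
  have hzero : ∀ J, ¬ γ ≤ J → p (grMinor k (Units.mk0 q hq) J) = 0 := by
    intro J hJ
    have : grMinor k (Units.mk0 q hq) J ∈
        (RingHom.ker (p : QuantumGrassmannian k (Units.mk0 q hq) m n →+* B) :
          Set (QuantumGrassmannian k (Units.mk0 q hq) m n)) := by
      rw [hker]
      exact TwoSidedIdeal.subset_span ⟨J, hJ, rfl⟩
    exact this
  let elem : {π : Fin m ↪o Fin n // γ ≤ π} → B := fun x => p (grMinor k (Units.mk0 q hq) x)
  have gen : Algebra.adjoin k (Set.range elem) = ⊤ := by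
    rw [eq_top_iff, ← (AlgHom.range_eq_top p).mpr hsurj, ← Algebra.map_top,
      ← QMat.adjoin_range_grMinor hq, AlgHom.map_adjoin]
    refine Algebra.adjoin_le ?_
    rintro _ ⟨_, ⟨J, rfl⟩, rfl⟩
    by_cases hJ : γ ≤ J
    · exact Algebra.subset_adjoin ⟨⟨J, hJ⟩, rfl⟩
    · exact (hzero J hJ).symm ▸ zero_mem _
  obtain ⟨D₀, hD₀⟩ := QMat.exists_coaction (n := n) hq hm
  obtain ⟨D, hD⟩ := QMat.exists_lift_of_ker_eq_span p hsurj (s := Ω) (by rw [hker])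
    ((Polynomial.mapAlgHom p).comp D₀) (by
      rintro _ ⟨J, hJ, rfl⟩
      rw [AlgHom.comp_apply, hD₀]
      exact (Polynomial.map_monomial _).trans (by simp [hzero J hJ]))
  obtain ⟨𝒜, ⟨graded⟩, hdeg⟩ := QMat.exists_gradedAlgebra D gen (by
    rintro _ ⟨J, rfl⟩
    rw [hD, AlgHom.comp_apply, hD₀]
    exact Polynomial.map_monomial _)
  have hspan : ∀ (a b : {π : Fin m ↪o Fin n // γ ≤ π})
      (z : QuantumGrassmannian k (Units.mk0 q hq) m n),
      z ∈ Submodule.span k {y | ∃ K L, K ≤ L ∧ (K < a.1 ∧ K < b.1) ∧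
        y = grMinor k (Units.mk0 q hq) K * grMinor k (Units.mk0 q hq) L} →
      p z ∈ Submodule.span k {x : B | ∃ lam : {π : Fin m ↪o Fin n // γ ≤ π}, lam < a ∧ lam < b ∧
        (x = elem lam ∨ ∃ mu, lam ≤ mu ∧ x = elem lam * elem mu)} := by
    intro a b z hz
    have := Submodule.mem_map_of_mem (f := p.toLinearMap) hz
    rw [Submodule.map_span] at this
    refine Submodule.span_le.mpr ?_ this
    rintro _ ⟨_, ⟨K, L, hKL, ⟨hKa, hKb⟩, rfl⟩, rfl⟩
    rw [SetLike.mem_coe, AlgHom.toLinearMap_apply, map_mul]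
    by_cases hK : γ ≤ K
    · exact Submodule.subset_span
        ⟨⟨K, hK⟩, hKa, hKb, Or.inr ⟨⟨L, hK.trans hKL⟩, hKL, rfl⟩⟩
    · rw [hzero K hK, zero_mul]
      exact zero_mem _
  refine ⟨𝒜, ⟨elem, graded, ?_, gen, ?_, ?_, ?_⟩, fun _ => rfl⟩
  · exact fun x => ⟨1, one_pos, hdeg _ ⟨x, rfl⟩⟩
  · obtain ⟨V, _, _, x, hx⟩ := QMat.exists_isModel hq hm γ
    obtain ⟨ψ, hψ⟩ := QMat.exists_lift_of_ker_eq_span p hsurj (s := Ω) (by rw [hker])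
      (hx.isQMat.grHom hq) (by
      rintro _ ⟨J, hJ, rfl⟩
      rw [hx.isQMat.grHom_grMinor, QMat.qMinor_eq_zero_of_zero hx.zero hJ])
    let f : {l : List {π : Fin m ↪o Fin n // γ ≤ π} // l.IsChain (· ≤ ·)} → QMat.StdList γ :=
      fun l => ⟨l.1.map Subtype.val, by
        rw [List.pairwise_map]
        exact List.isChain_iff_pairwise.mp l.2, by
        simp only [List.mem_map]
        rintro _ ⟨J, _, rfl⟩
        exact J.2⟩
    have hf : Function.Injective f := fun l l' h =>
      Subtype.ext (List.map_injective_iff.mpr Subtype.val_injective (congrArg Subtype.val h))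
    have hcomp : ψ.toLinearMap ∘ (fun l : {l : List {π : Fin m ↪o Fin n // γ ≤ π} //
        l.IsChain (· ≤ ·)} => (l.1.map elem).prod) =
        (fun l : QMat.StdList γ => (l.1.map (QMat.qMinor q x)).prod) ∘ f := by
      funext l
      simp only [Function.comp_apply, AlgHom.toLinearMap_apply, map_list_prod, List.map_map, f]
      congr 2
      funext J
      simp [elem, hψ, hx.isQMat.grHom_grMinor]
    have h := hx.indep.comp f hf
    rw [← hcomp] at h
    exact LinearIndependent.of_comp ψ.toLinearMap h
  · intro a b hab hba
    rw [← map_mul]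
    exact hspan a b _ (QMat.grMinor_straighten hq hm hab hba)
  · intro a b
    obtain ⟨c, hc, h⟩ := QMat.grMinor_comm hq hm a.1 b.1
    refine ⟨-c, neg_ne_zero.mpr hc, ?_⟩
    have := hspan a b _ h
    rwa [map_add, map_smul, map_mul, map_mul, ← sub_neg_eq_add, ← neg_smul] at this
end

section
/- Let q be a nonzero element of a field k and let m ≤ n be positive integers. Let (I,J) ∈ Δ_{m,n} with I = {i₁<⋯<i_t} ⊆ {1,…,m} and J = {j₁<⋯<j_t} ⊆ {1,…,n}, and let K_{(I,J)} ∈ Π_{m,n+m} be the index set obtained by ordering {j₁,…,j_t, n+1,…,n+m}∖{n+m+1−i₁,…,n+m+1−i_t}. Then the dehomogenisation isomorphism D_{m,n} : O_q(M_{m,n}(k))[y,y⁻¹;φ] → O_q(G_{m,n+m}(k))[[n+1,…,n+m]⁻¹] satisfies D_{m,n}([I|J]) = [K_{(I,J)}]·[{n+1,…,n+m}]⁻¹. -/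
/-- An index pair `(I,J) ∈ Δ_{m,n}`: a pair of subsets `I ⊆ {1,…,m}`, `J ⊆ {1,…,n}` with
`|I| = |J| = t` for some `1 ≤ t ≤ m`, encoded by strictly increasing enumerations. -/
structure DeltaIdx (m n : ℕ) where
  /-- the common cardinality of the two index sets -/
  t : ℕ
  t_pos : 0 < t
  t_le : t ≤ m
  /-- the row index set `I = {i₁ < ⋯ < i_t}` -/
  I : Fin t ↪o Fin m
  /-- the column index set `J = {j₁ < ⋯ < j_t}` -/
  J : Fin t ↪o Fin n

namespace DeltaIdx

/-- The standard partial order on `Δ_{m,n}`:  `(I,J) ≤st (K,L)` iff `|I| ≥ |K| = v`,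
`i_s ≤ k_s` and `j_s ≤ l_s` for `1 ≤ s ≤ v`. -/
instance (m n : ℕ) : PartialOrder (DeltaIdx m n) where
  le P Q := ∃ h : Q.t ≤ P.t,
    (∀ s : Fin Q.t, P.I (Fin.castLE h s) ≤ Q.I s) ∧
    (∀ s : Fin Q.t, P.J (Fin.castLE h s) ≤ Q.J s)
  le_refl P := ⟨le_rfl, fun s => le_of_eq (congrArg P.I (Fin.ext rfl)),
    fun s => le_of_eq (congrArg P.J (Fin.ext rfl))⟩
  le_trans P Q R := by
    rintro ⟨h1, hI1, hJ1⟩ ⟨h2, hI2, hJ2⟩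
    refine ⟨h2.trans h1, fun s => ?_, fun s => ?_⟩
    · have e : Fin.castLE (h2.trans h1) s = Fin.castLE h1 (Fin.castLE h2 s) := Fin.ext rfl
      rw [e]
      exact (hI1 _).trans (hI2 s)
    · have e : Fin.castLE (h2.trans h1) s = Fin.castLE h1 (Fin.castLE h2 s) := Fin.ext rfl
      rw [e]
      exact (hJ1 _).trans (hJ2 s)
  le_antisymm P Q := by
    rintro ⟨h1, hI1, hJ1⟩ ⟨h2, hI2, hJ2⟩
    obtain ⟨t, ht0, htm, I, J⟩ := P
    obtain ⟨t', ht0', htm', I', J'⟩ := Q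
    dsimp only at h1 h2 hI1 hI2 hJ1 hJ2
    have ht : t = t' := le_antisymm h2 h1
    subst ht
    have eI : I = I' := by
      ext s
      have e : Fin.castLE h1 s = s := Fin.ext rfl
      have e2 : Fin.castLE h2 s = s := Fin.ext rfl
      exact congrArg Fin.val (le_antisymm (by simpa [e] using hI1 s) (by simpa [e2] using hI2 s))
    have eJ : J = J' := by
      ext s
      have e : Fin.castLE h1 s = s := Fin.ext rfl
      have e2 : Fin.castLE h2 s = s := Fin.ext rfl
      exact congrArg Fin.val (le_antisymm (by simpa [e] using hJ1 s) (by simpa [e2] using hJ2 s))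
    rw [eI, eJ]

/-- The padding map used to prove that `Δ_{m,n}` is finite. -/
def pad {m n : ℕ} (P : DeltaIdx m n) :
    (Fin m → WithTop (Fin m)) × (Fin m → WithTop (Fin n)) :=
  (fun s => if h : (s : ℕ) < P.t then (P.I ⟨s, h⟩ : WithTop (Fin m)) else ⊤,
   fun s => if h : (s : ℕ) < P.t then (P.J ⟨s, h⟩ : WithTop (Fin n)) else ⊤)

lemma pad_injective {m n : ℕ} : Function.Injective (pad (m := m) (n := n)) := by
  intro P Q hPQ
  have h1 := congrArg Prod.fst hPQ
  have h2 := congrArg Prod.snd hPQ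
  simp only [pad] at h1 h2
  have ht : P.t = Q.t := by
    by_contra hne
    rcases Nat.lt_or_ge P.t Q.t with h | h
    · have hfun := congrFun h1 ⟨P.t, lt_of_lt_of_le h Q.t_le⟩
      rw [dif_neg (by simp), dif_pos (by simpa using h)] at hfun
      exact (WithTop.coe_ne_top (hfun.symm)).elim
    · rcases Nat.lt_or_ge Q.t P.t with h' | h'
      · have hfun := congrFun h1 ⟨Q.t, lt_of_lt_of_le h' P.t_le⟩
        rw [dif_pos (by simpa using h'), dif_neg (by simp)] at hfun
        exact (WithTop.coe_ne_top hfun).elim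
      · exact hne (le_antisymm h' h)
  obtain ⟨t, ht0, htm, I, J⟩ := P
  obtain ⟨t', ht0', htm', I', J'⟩ := Q
  dsimp only at ht h1 h2
  subst ht
  have eI : I = I' := by
    ext s
    have hfun := congrFun h1 ⟨(s : ℕ), lt_of_lt_of_le s.isLt htm⟩
    rw [dif_pos (by simp), dif_pos (by simp)] at hfun
    have : I ⟨(s : ℕ), s.isLt⟩ = I' ⟨(s : ℕ), s.isLt⟩ := by
      exact_mod_cast hfun
    simpa using congrArg Fin.val this
  have eJ : J = J' := by
    ext s
    have hfun := congrFun h2 ⟨(s : ℕ), lt_of_lt_of_le s.isLt htm⟩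
    rw [dif_pos (by simp), dif_pos (by simp)] at hfun
    have : J ⟨(s : ℕ), s.isLt⟩ = J' ⟨(s : ℕ), s.isLt⟩ := by
      exact_mod_cast hfun
    simpa using congrArg Fin.val this
  rw [eI, eJ]

instance (m n : ℕ) : Finite (DeltaIdx m n) := by
  have : Finite (WithTop (Fin m)) := inferInstanceAs (Finite (Option (Fin m)))
  have : Finite (WithTop (Fin n)) := inferInstanceAs (Finite (Option (Fin n)))
  exact Finite.of_injective pad pad_injective

end DeltaIdx

/-- The `t × t` quantum minor `[I|J]` of the generic matrix, for `(I,J) ∈ Δ_{m,n}`. -/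
def qMinor (R : Type*) [CommRing R] (u : Rˣ) {m n : ℕ} (P : DeltaIdx m n) :
    QuantumMat R u m n :=
  ∑ σ : Equiv.Perm (Fin P.t),
    ((-(u : R)) ^ permLength σ) •
      (List.ofFn fun s : Fin P.t => qX R u (P.I s) (P.J (σ s))).prod

/-- The maximal quantum minor `[S]` of `O_u(M_{m,N}(R))` indexed by a finset
`S ⊆ {1,…,N}` (interpreted as `0` in the degenerate case `|S| ≠ m`). -/
noncomputable def qMaxMinorSet (R : Type*) [CommRing R] (u : Rˣ) {m N : ℕ}
    (S : Finset (Fin N)) : QuantumMat R u m N :=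
  if h : S.card = m then qMaximalMinor R u (S.orderEmbOfFin h) else 0

lemma qMaxMinorSet_mem (R : Type*) [CommRing R] (u : Rˣ) {m N : ℕ} (S : Finset (Fin N)) :
    qMaxMinorSet R u S ∈ QuantumGrassmannian R u m N := by
  unfold qMaxMinorSet
  split
  · exact Algebra.subset_adjoin ⟨_, rfl⟩
  · exact Subalgebra.zero_mem _

/-- The maximal quantum minor `[S]` as an element of the quantum grassmannian. -/
noncomputable def grSetMinor (R : Type*) [CommRing R] (u : Rˣ) {m N : ℕ}
    (S : Finset (Fin N)) : QuantumGrassmannian R u m N :=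
  ⟨qMaxMinorSet R u S, qMaxMinorSet_mem R u S⟩

/-- The singleton index set `{i}`, as an order embedding `Fin 1 ↪o Fin N`. -/
def singleEmb {N : ℕ} (i : Fin N) : Fin 1 ↪o Fin N :=
  OrderEmbedding.ofStrictMono (fun _ => i)
    (fun a b h => absurd (Subsingleton.elim a b) (ne_of_lt h))

/-- The index set `K_{(I,J)} ∈ Π_{m,n+m}` associated to an index pair `(I,J) ∈ Δ_{m,n}`:
the `m`-element subset of `{1,…,n+m}` obtained by ordering
`{j₁,…,j_t, n+1,…,n+m} ∖ {n+m+1−i₁,…,n+m+1−i_t}` (as a `Finset` of `Fin (n+m)`,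
`0`-indexed). -/
def deltaImage {m n : ℕ} (P : DeltaIdx m n) : Finset (Fin (n + m)) :=
  ((Finset.univ.image fun s : Fin P.t => Fin.castLE (Nat.le_add_right n m) (P.J s)) ∪
      (Finset.univ.image fun i : Fin m => Fin.natAdd n i)) \
    (Finset.univ.image fun s : Fin P.t => Fin.natAdd n (Fin.rev (P.I s)))

/-! ### Quantum minors along a list of rows -/

namespace QMinor

open Finset

section Counting

variable {β : Type*} [LinearOrder β]

/-- The number of elements of `S` strictly below `x`. -/
def below (S : Finset β) (x : β) : ℕ := #{y ∈ S | y < x}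

/-- The number of elements of `S` strictly above `x`. -/
def above (S : Finset β) (x : β) : ℕ := #{y ∈ S | x < y}

lemma below_erase_of_lt {S : Finset β} {x y : β} (hx : x ∈ S) (hxy : x < y) :
    below (S.erase x) y + 1 = below S y := by
  unfold below
  rw [filter_erase, card_erase_add_one (by simp [hx, hxy])]

lemma below_erase_of_le {S : Finset β} {x y : β} (hxy : y ≤ x) :
    below (S.erase x) y = below S y := by
  unfold below
  rw [filter_erase, erase_eq_of_notMem (by simp [hxy])]

lemma above_erase_of_lt {S : Finset β} {x y : β} (hx : x ∈ S) (hxy : y < x) :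
    above (S.erase x) y + 1 = above S y := by
  unfold above
  rw [filter_erase, card_erase_add_one (by simp [hx, hxy])]

lemma above_erase_of_le {S : Finset β} {x y : β} (hxy : x ≤ y) :
    above (S.erase x) y = above S y := by
  unfold above
  rw [filter_erase, erase_eq_of_notMem (by simp [hxy])]

lemma below_eq_zero {S : Finset β} {x : β} (h : ∀ y ∈ S, x ≤ y) : below S x = 0 :=
  card_eq_zero.2 (filter_eq_empty_iff.2 fun y hy => (h y hy).not_gt)

lemma below_add_above {S : Finset β} {x : β} (hx : x ∈ S) :
    below S x + above S x + 1 = #S := by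
  unfold below above
  rw [← card_union_of_disjoint, ← card_erase_add_one hx]
  · congr 2
    ext y
    simp only [mem_union, mem_filter, mem_erase, ne_iff_lt_or_gt]
    tauto
  · rw [disjoint_left]
    intro y
    simp only [mem_filter, not_and, not_lt]
    exact fun h _ => h.2.le

lemma sort_eq_append (S : Finset β) {x : β} (hx : x ∉ S) :
    ∃ L₁ L₂ : List β, S.sort = L₁ ++ L₂ ∧ (insert x S).sort = L₁ ++ x :: L₂ ∧
      (∀ y ∈ L₁, y < x) ∧ (∀ y ∈ L₂, x < y) ∧ L₁.length = below S x ∧ L₂.length = above S x := by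
  induction S using Finset.induction_on_min with
  | empty => exact ⟨[], [], by simp, by simp, by simp, by simp, by simp [below], by simp [above]⟩
  | insert a S ha ih =>
    have haS : a ∉ S := fun h => lt_irrefl _ (ha a h)
    have hsort : (insert a S).sort = a :: S.sort := sort_insert _ (fun b hb => (ha b hb).le) haS
    rcases lt_trichotomy x a with h | rfl | h
    · refine ⟨[], a :: S.sort, by simp [hsort], ?_, by simp, ?_, ?_, ?_⟩
      · rw [sort_insert _ _ hx, hsort]
        · rfl
        · intro b hb
          rcases mem_insert.1 hb with rfl | hb
          exacts [h.le, (h.trans (ha b hb)).le]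
      · intro y hy
        rcases List.mem_cons.1 hy with rfl | hy
        exacts [h, h.trans (ha y ((mem_sort _).1 hy))]
      · refine (below_eq_zero fun b hb => ?_).symm
        rcases mem_insert.1 hb with rfl | hb
        exacts [h.le, (h.trans (ha b hb)).le]
      · rw [above, filter_true_of_mem, ← hsort, length_sort]
        intro b hb
        rcases mem_insert.1 hb with rfl | hb
        exacts [h, h.trans (ha b hb)]
    · exact absurd (mem_insert_self _ _) hx
    · obtain ⟨L₁, L₂, h₁, h₂, h₃, h₄, h₅, h₆⟩ := ih fun hxS => hx (mem_insert_of_mem hxS)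
      refine ⟨a :: L₁, L₂, by simp [hsort, h₁], ?_, ?_, h₄, ?_, ?_⟩
      · rw [insert_comm, sort_insert, h₂]
        · rfl
        · intro b hb
          rcases mem_insert.1 hb with rfl | hb
          exacts [h.le, (ha b hb).le]
        · simp [haS, h.ne]
      · intro y hy
        rcases List.mem_cons.1 hy with rfl | hy
        exacts [h, h₃ y hy]
      · rw [List.length_cons, h₅, ← below_erase_of_lt (mem_insert_self a S) h,
          erase_insert haS]
      · rw [h₆, ← above_erase_of_le (S := insert a S) h.le, erase_insert haS]

lemma sort_eq_cons {S : Finset β} {x : β} (hx : x ∈ S) (hmin : ∀ y ∈ S, x ≤ y) :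
    S.sort = x :: (S.erase x).sort := by
  conv_lhs => rw [← insert_erase hx]
  exact sort_insert _ (fun b hb => hmin b (mem_of_mem_erase hb)) (notMem_erase x S)

end Counting

variable {R A α β : Type*} [CommRing R] [Ring A] [Algebra R A]

/-- The entries of `Z` satisfy the relations of quantum matrices with parameter `u`. -/
structure IsQuantum [LinearOrder α] [LinearOrder β] (u : Rˣ) (Z : α → β → A) : Prop where
  row : ∀ i j l, j < l → Z i j * Z i l = (u : R) • (Z i l * Z i j)
  col : ∀ i k j, i < k → Z i j * Z k j = (u : R) • (Z k j * Z i j)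
  antidiag : ∀ i k j l, k < i → j < l → Z i j * Z k l = Z k l * Z i j
  diag : ∀ i k j l, i < k → j < l →
    Z i j * Z k l = Z k l * Z i j + ((u : R) - ((u⁻¹ : Rˣ) : R)) • (Z i l * Z k j)

lemma IsQuantum.transpose [LinearOrder α] [LinearOrder β] {u : Rˣ} {Z : α → β → A}
    (hZ : IsQuantum u Z) : IsQuantum u fun j i => Z i j where
  row i j l h := hZ.col j l i h
  col i k j h := hZ.row j i k h
  antidiag i k j l h h' := (hZ.antidiag l j k i h' h).symm
  diag i k j l h h' := by
    rw [hZ.diag j l i k h' h, hZ.antidiag l j i k h' h]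

section Minor

variable [LinearOrder β]

/-- The quantum minor of `Z` with (ordered) row sequence `L` and column set `S`, defined by
expansion along the first row, with `p` in the role of `-q`. -/
def rowMinor (p : R) (Z : α → β → A) : List α → Finset β → A
  | [], S => if S = ∅ then 1 else 0
  | r :: L, S => ∑ x ∈ S, p ^ below S x • (Z r x * rowMinor p Z L (S.erase x))

variable {p : R} {Z : α → β → A}

@[simp]
lemma rowMinor_nil (S : Finset β) : rowMinor p Z [] S = if S = ∅ then 1 else 0 := rfl

lemma rowMinor_cons (r : α) (L : List α) (S : Finset β) :
    rowMinor p Z (r :: L) S = ∑ x ∈ S, p ^ below S x • (Z r x * rowMinor p Z L (S.erase x)) :=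
  rfl

lemma rowMinor_eq_zero_of_card_ne (L : List α) (S : Finset β) (h : #S ≠ L.length) :
    rowMinor p Z L S = 0 := by
  induction L generalizing S with
  | nil => exact if_neg fun hS => h (by simp [hS])
  | cons r L ih =>
    refine sum_eq_zero fun x hx => ?_
    rw [ih, mul_zero, smul_zero]
    intro h'
    rw [← card_erase_add_one hx, List.length_cons, h'] at h
    exact h rfl

lemma map_rowMinor {B : Type*} [Ring B] [Algebra R B] (f : A →ₐ[R] B) (L : List α)
    (S : Finset β) : f (rowMinor p Z L S) = rowMinor p (fun i j => f (Z i j)) L S := by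
  induction L generalizing S with
  | nil => rw [rowMinor_nil, rowMinor_nil]; split_ifs <;> simp
  | cons r L ih => simp [rowMinor_cons, ih]

lemma rowMinor_append_congr (L : List α) {L₁ L₂ : List α} {c : R}
    (h : ∀ S, rowMinor p Z L₁ S = c • rowMinor p Z L₂ S) (S : Finset β) :
    rowMinor p Z (L ++ L₁) S = c • rowMinor p Z (L ++ L₂) S := by
  induction L generalizing S with
  | nil => exact h S
  | cons r L ih =>
    simp only [List.cons_append, rowMinor_cons, ih, smul_sum, mul_smul_comm]
    exact sum_congr rfl fun x _ => smul_comm _ _ _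

lemma rowMinor_cons_cons (r s : α) (L : List α) (S : Finset β) :
    rowMinor p Z (r :: s :: L) S = ∑ x ∈ S, ∑ y ∈ S with x < y,
      p ^ (below S x + below (S.erase x) y) •
        ((Z r x * Z s y + p • (Z r y * Z s x)) * rowMinor p Z L ((S.erase x).erase y)) := by
  have key : ∀ f : β → β → A, ∑ x ∈ S, ∑ y ∈ S.erase x, f x y =
      ∑ x ∈ S, ∑ y ∈ S with x < y, (f x y + f y x) := by
    intro f
    have h₁ : ∀ x ∈ S, ∑ y ∈ S.erase x, f x y =
        ∑ y ∈ S with x < y, f x y + ∑ y ∈ S with y < x, f x y := by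
      intro x _
      rw [← sum_union]
      · refine sum_congr ?_ fun _ _ => rfl
        ext y
        simp only [mem_union, mem_filter, mem_erase, ne_iff_lt_or_gt]
        tauto
      · rw [disjoint_left]
        intro y
        simp only [mem_filter, not_and, not_lt]
        exact fun h _ => h.2.le
    rw [sum_congr rfl h₁, sum_add_distrib]
    simp only [sum_add_distrib]
    congr 1
    refine sum_comm' fun x y => ?_
    simp only [mem_filter]
    tauto
  simp only [rowMinor_cons, mul_sum, smul_sum]
  rw [key]
  refine sum_congr rfl fun x hx => sum_congr rfl fun y hy => ?_
  obtain ⟨hy, hxy⟩ := mem_filter.1 hy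
  rw [erase_right_comm (a := y) (b := x), below_erase_of_le hxy.le,
    ← below_erase_of_lt hx hxy]
  simp only [mul_smul_comm, smul_smul, add_mul, smul_add, smul_mul_assoc, mul_assoc, ← pow_add,
    ← pow_succ]
  congr 3
  ring

end Minor

section Antisymmetry

variable [LinearOrder α] [LinearOrder β] {u : Rˣ} {Z : α → β → A}

lemma IsQuantum.rowMinor_self_cons (hZ : IsQuantum u Z) (r : α) (L : List α) (S : Finset β) :
    rowMinor (-(u : R)) Z (r :: r :: L) S = 0 := by
  rw [rowMinor_cons_cons]
  refine sum_eq_zero fun x _ => sum_eq_zero fun y hy => ?_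
  rw [hZ.row r x y (mem_filter.1 hy).2]
  simp

lemma IsQuantum.rowMinor_swap (hZ : IsQuantum u Z) {r s : α} (h : s < r) (L : List α)
    (S : Finset β) :
    rowMinor (-(u : R)) Z (r :: s :: L) S = (-(u : R)) • rowMinor (-(u : R)) Z (s :: r :: L) S := by
  rw [rowMinor_cons_cons, rowMinor_cons_cons, smul_sum]
  refine sum_congr rfl fun x _ => ?_
  rw [smul_sum]
  refine sum_congr rfl fun y hy => ?_
  have hxy := (mem_filter.1 hy).2
  have key : Z r x * Z s y + (-(u : R)) • (Z r y * Z s x) =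
      (-(u : R)) • (Z s x * Z r y + (-(u : R)) • (Z s y * Z r x)) := by
    have hu : (-(u : R)) * ((u : R) - ((u⁻¹ : Rˣ) : R)) = 1 - (u : R) * u := by
      linear_combination u.mul_inv
    rw [hZ.diag s r x y h hxy, hZ.antidiag r s x y h hxy, smul_add, smul_add, smul_smul, hu]
    module
  rw [key, smul_mul_assoc, smul_comm]

lemma IsQuantum.rowMinor_cons_of_mem (hZ : IsQuantum u Z) {r : α} {L : List α} (h : r ∈ L)
    (S : Finset β) : rowMinor (-(u : R)) Z (r :: L) S = 0 := by
  induction L generalizing S with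
  | nil => simp at h
  | cons s L ih =>
    rcases eq_or_ne r s with rfl | hrs
    · exact hZ.rowMinor_self_cons r L S
    · have h0 : rowMinor (-(u : R)) Z (s :: r :: L) S = 0 := by
        rw [rowMinor_cons]
        exact sum_eq_zero fun x _ => by rw [ih (by simpa [hrs] using h), mul_zero, smul_zero]
      rcases lt_or_gt_of_ne hrs with hlt | hlt
      · rw [hZ.rowMinor_swap hlt] at h0
        have h1 := congrArg (fun a : A => -((u⁻¹ : Rˣ) : R) • a) h0
        simpa [smul_smul] using h1
      · rw [hZ.rowMinor_swap hlt, h0, smul_zero]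

lemma IsQuantum.rowMinor_cons_append (hZ : IsQuantum u Z) {r : α} {L₁ : List α}
    (h : ∀ s ∈ L₁, s < r) (L₂ : List α) (S : Finset β) :
    rowMinor (-(u : R)) Z (r :: (L₁ ++ L₂)) S =
      (-(u : R)) ^ L₁.length • rowMinor (-(u : R)) Z (L₁ ++ r :: L₂) S := by
  induction L₁ generalizing S with
  | nil => simp
  | cons s L₁ ih =>
    rw [List.cons_append, hZ.rowMinor_swap (h s (by simp)), List.length_cons, pow_succ', mul_smul]
    congr 1
    exact rowMinor_append_congr [s] (ih fun t ht => h t (by simp [ht])) S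

lemma IsQuantum.rowMinor_append_singleton (hZ : IsQuantum u Z) {r : α} (L₁ : List α)
    {L₂ : List α} (h : ∀ s ∈ L₂, r < s) (S : Finset β) :
    rowMinor (-(u : R)) Z ((L₁ ++ L₂) ++ [r]) S =
      (-(u : R)) ^ L₂.length • rowMinor (-(u : R)) Z (L₁ ++ r :: L₂) S := by
  rw [List.append_assoc]
  refine rowMinor_append_congr L₁ (fun S => ?_) S
  induction L₂ generalizing S with
  | nil => simp
  | cons s L₂ ih =>
    rw [List.cons_append]
    refine (rowMinor_append_congr [s] (ih fun t ht => h t (by simp [ht])) S).trans ?_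
    rw [List.singleton_append, hZ.rowMinor_swap (h s (by simp)), smul_smul, List.length_cons,
      pow_succ]

lemma IsQuantum.rowMinor_append_singleton_of_mem (hZ : IsQuantum u Z) {r : α} {L : List α}
    (h : r ∈ L) (S : Finset β) : rowMinor (-(u : R)) Z (L ++ [r]) S = 0 := by
  obtain ⟨L₁, L₂, rfl⟩ := List.append_of_mem h
  rw [List.append_assoc, rowMinor_append_congr (c := (0 : R)) (L₂ := []), zero_smul]
  intro S
  rw [zero_smul, List.cons_append]
  exact hZ.rowMinor_cons_of_mem (by simp) S

end Antisymmetry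

lemma rowMinor_append_last [LinearOrder β] {p : R} {Z : α → β → A} (L : List α) (r : α)
    (S : Finset β) :
    rowMinor p Z (L ++ [r]) S =
      ∑ x ∈ S, p ^ above S x • (rowMinor p Z L (S.erase x) * Z r x) := by
  induction L generalizing S with
  | nil =>
    rw [List.nil_append, rowMinor_cons]
    refine sum_congr rfl fun x hx => ?_
    by_cases h : S.erase x = ∅
    · have hS : S = {x} := by rw [← insert_erase hx, h]; rfl
      subst hS
      simp [below, above, filter_singleton]
    · simp [h]
  | cons s L ih =>
    simp only [List.cons_append, rowMinor_cons, ih, mul_sum, sum_mul, smul_sum]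
    rw [sum_comm' (t' := S) (s' := fun y => S.erase y)
      (fun x y => by simp only [mem_erase]; tauto)]
    refine sum_congr rfl fun x hx => sum_congr rfl fun y hy => ?_
    obtain ⟨hyx, hy⟩ := mem_erase.1 hy
    rw [erase_right_comm]
    simp only [smul_mul_assoc, mul_smul_comm, smul_smul, ← pow_add, mul_assoc]
    congr 2
    rcases lt_or_gt_of_ne hyx with h | h
    · rw [below_erase_of_le h.le, above_erase_of_le h.le, add_comm]
    · rw [← below_erase_of_lt hx h, ← above_erase_of_lt hy h]
      ring

end QMinor

namespace QMinor

open Finset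

variable {R A α β : Type*} [CommRing R] [Ring A] [Algebra R A] [LinearOrder α] [LinearOrder β]
  {u : Rˣ} {Z : α → β → A}

/-- Expansion along rows and expansion along columns give the same quantum minor. -/
lemma IsQuantum.rowMinor_sort (hZ : IsQuantum u Z) (S : Finset α) (T : Finset β) :
    rowMinor (-(u : R)) Z S.sort T = rowMinor (-(u : R)) (fun j i => Z i j) T.sort S := by
  induction hn : #S using Nat.strong_induction_on generalizing S T with
  | _ N ih =>
  rcases S.eq_empty_or_nonempty with rfl | hS
  · rcases T.eq_empty_or_nonempty with rfl | hT
    · simp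
    · rw [rowMinor_eq_zero_of_card_ne, rowMinor_eq_zero_of_card_ne] <;>
        simp [hT.ne_empty, eq_comm]
  rcases T.eq_empty_or_nonempty with rfl | hT
  · rw [rowMinor_eq_zero_of_card_ne, rowMinor_eq_zero_of_card_ne] <;>
      simp [hS.ne_empty, eq_comm]
  obtain ⟨r, hr, hrmin⟩ : ∃ r ∈ S, ∀ y ∈ S, r ≤ y :=
    ⟨S.min' hS, S.min'_mem hS, fun y hy => S.min'_le y hy⟩
  obtain ⟨c, hc, hcmin⟩ : ∃ c ∈ T, ∀ y ∈ T, c ≤ y :=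
    ⟨T.min' hT, T.min'_mem hT, fun y hy => T.min'_le y hy⟩
  have hcard : ∀ s ∈ S, #(S.erase s) < N := fun s hs => hn ▸ card_erase_lt_of_mem hs
  rw [sort_eq_cons hr hrmin, sort_eq_cons hc hcmin, rowMinor_cons, rowMinor_cons,
    ← add_sum_erase _ _ hc, ← add_sum_erase _ _ hr]
  congr 1
  · rw [below_eq_zero hrmin, below_eq_zero hcmin, ih _ (hcard r hr) _ _ rfl]
  have h₁ : ∀ x ∈ T.erase c, rowMinor (-(u : R)) Z (S.erase r).sort (T.erase x) =
      ∑ s ∈ S.erase r, (-(u : R)) ^ below (S.erase r) s • (Z s c *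
        rowMinor (-(u : R)) (fun j i => Z i j) ((T.erase c).erase x).sort
          ((S.erase r).erase s)) := by
    intro x hx
    rw [ih _ (hcard r hr) _ _ rfl, sort_eq_cons (mem_erase.2 ⟨(ne_of_mem_erase hx).symm, hc⟩)
      fun y hy => hcmin y (mem_of_mem_erase hy), rowMinor_cons, erase_right_comm]
  have h₂ : ∀ s ∈ S.erase r, rowMinor (-(u : R)) (fun j i => Z i j) (T.erase c).sort (S.erase s) =
      ∑ x ∈ T.erase c, (-(u : R)) ^ below (T.erase c) x • (Z r x *
        rowMinor (-(u : R)) (fun j i => Z i j) ((T.erase c).erase x).sort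
          ((S.erase r).erase s)) := by
    intro s hs
    rw [← ih _ (hcard s (mem_of_mem_erase hs)) _ _ rfl,
      sort_eq_cons (mem_erase.2 ⟨(ne_of_mem_erase hs).symm, hr⟩)
      fun y hy => hrmin y (mem_of_mem_erase hy), rowMinor_cons, erase_right_comm]
    refine sum_congr rfl fun x _ => ?_
    rw [ih _ _ _ _ rfl]
    exact (card_le_card (erase_subset _ _)).trans_lt (hcard r hr)
  refine (sum_congr rfl fun x hx => by rw [h₁ x hx, mul_sum, smul_sum]).trans
    (sum_comm.trans (sum_congr rfl fun s hs => ?_))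
  rw [h₂ s hs, mul_sum, smul_sum]
  refine sum_congr rfl fun x hx => ?_
  obtain ⟨hsr, hs⟩ := mem_erase.1 hs
  obtain ⟨hxc, hx⟩ := mem_erase.1 hx
  have hrs := lt_of_le_of_ne (hrmin s hs) hsr.symm
  have hcx := lt_of_le_of_ne (hcmin x hx) hxc.symm
  rw [← below_erase_of_lt hr hrs, ← below_erase_of_lt hc hcx]
  simp only [mul_smul_comm, smul_smul, ← mul_assoc, ← pow_add]
  rw [hZ.antidiag s r c x hrs hcx]
  congr 2
  ring

/-- Appending a row to a sorted sequence of rows and sorting the result. -/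
lemma IsQuantum.rowMinor_sort_append (hZ : IsQuantum u Z) {S : Finset α} {r : α} (hr : r ∉ S)
    (T : Finset β) :
    rowMinor (-(u : R)) Z (S.sort ++ [r]) T =
      (-(u : R)) ^ above S r • rowMinor (-(u : R)) Z (insert r S).sort T := by
  obtain ⟨L₁, L₂, h₁, h₂, -, h₄, -, h₆⟩ := sort_eq_append S hr
  rw [h₁, h₂, hZ.rowMinor_append_singleton L₁ h₄, h₆]

lemma IsQuantum.rowMinor_cons_sort (hZ : IsQuantum u Z) {S : Finset α} {r : α} (hr : r ∉ S)
    (T : Finset β) :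
    rowMinor (-(u : R)) Z (r :: S.sort) T =
      (-(u : R)) ^ below S r • rowMinor (-(u : R)) Z (insert r S).sort T := by
  obtain ⟨L₁, L₂, h₁, h₂, h₃, -, h₅, -⟩ := sort_eq_append S hr
  rw [h₁, h₂, hZ.rowMinor_cons_append h₃, h₅]

/-- Expansion along the last column of a minor whose last column is out of place. -/
lemma IsQuantum.colMinor_append (hZ : IsQuantum u Z) (S : Finset α) (T : Finset β) (c : β) :
    rowMinor (-(u : R)) (fun j i => Z i j) (T.sort ++ [c]) S =
      ∑ s ∈ S, (-(u : R)) ^ above S s • (rowMinor (-(u : R)) Z (S.erase s).sort T * Z s c) := by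
  rw [rowMinor_append_last]
  exact sum_congr rfl fun s _ => by rw [hZ.rowMinor_sort]

/-- The quantum Plücker relations. -/
lemma IsQuantum.pluecker (hZ : IsQuantum u Z) (S : Finset α) (B C : Finset β) :
    ∑ x ∈ C \ B, (-(u : R)) ^ (below C x + above B x) •
      (rowMinor (-(u : R)) Z S.sort (insert x B) * rowMinor (-(u : R)) Z S.sort (C.erase x)) =
      0 := by
  have h : ∑ x ∈ C, (-(u : R)) ^ below C x •
      (rowMinor (-(u : R)) (fun j i => Z i j) (B.sort ++ [x]) S *
        rowMinor (-(u : R)) Z S.sort (C.erase x)) = 0 := by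
    simp only [hZ.colMinor_append, sum_mul, smul_sum]
    rw [sum_comm]
    refine sum_eq_zero fun s hs => ?_
    have h0 := hZ.rowMinor_cons_of_mem (L := S.sort) ((mem_sort _).2 hs) C
    have h1 := congrArg (fun a : A => (-(u : R)) ^ above S s •
      (rowMinor (-(u : R)) Z (S.erase s).sort B * a)) h0
    simp only [rowMinor_cons, mul_sum, smul_sum, mul_zero, smul_zero] at h1
    rw [← h1]
    refine sum_congr rfl fun x _ => ?_
    simp only [smul_mul_assoc, mul_smul_comm, smul_smul, mul_assoc, mul_comm]
  rw [← h]
  refine sum_subset_zero_on_sdiff sdiff_subset (fun x hx => ?_) fun x hx => ?_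
  · have hxB : x ∈ B := by
      by_contra hxB
      exact (mem_sdiff.1 hx).2 (mem_sdiff.2 ⟨(mem_sdiff.1 hx).1, hxB⟩)
    rw [hZ.transpose.rowMinor_append_singleton_of_mem ((mem_sort _).2 hxB), zero_mul, smul_zero]
  · rw [hZ.transpose.rowMinor_sort_append (mem_sdiff.1 hx).2, ← hZ.rowMinor_sort, pow_add,
      mul_smul, smul_mul_assoc]

lemma IsQuantum.sum_mul_colMinor_append (hZ : IsQuantum u Z) {S : Finset α} {T : Finset β}
    {r : α} (hr : r ∈ S) (c : β) :
    ∑ x ∈ T, (-(u : R)) ^ below T x •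
      (Z r x * rowMinor (-(u : R)) (fun j i => Z i j) ((T.erase x).sort ++ [c]) S) =
      (-(u : R)) ^ (#S - 1) • (rowMinor (-(u : R)) Z S.sort T * Z r c) := by
  have h : ∑ x ∈ T, (-(u : R)) ^ below T x •
      (Z r x * rowMinor (-(u : R)) (fun j i => Z i j) ((T.erase x).sort ++ [c]) S) =
      ∑ s ∈ S, (-(u : R)) ^ above S s •
        (rowMinor (-(u : R)) Z (r :: (S.erase s).sort) T * Z s c) := by
    simp only [hZ.colMinor_append, rowMinor_cons, sum_mul, mul_sum, smul_sum]
    rw [sum_comm]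
    refine sum_congr rfl fun s _ => sum_congr rfl fun x _ => ?_
    simp only [smul_mul_assoc, mul_smul_comm, smul_smul, mul_assoc, mul_comm]
  rw [h, sum_eq_single_of_mem r hr]
  · rw [hZ.rowMinor_cons_sort (notMem_erase r S), insert_erase hr, smul_mul_assoc, smul_smul,
      ← pow_add, below_erase_of_le le_rfl, ← below_add_above hr, add_comm]
    rfl
  · intro s _ hsr
    rw [hZ.rowMinor_cons_of_mem ((mem_sort _).2 (mem_erase.2 ⟨hsr.symm, hr⟩)), zero_mul, smul_zero]

lemma smul_pow_neg_unit_injective (n : ℕ) {a b : A}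
    (h : (-(u : R)) ^ n • a = (-(u : R)) ^ n • b) : a = b := by
  have hu : IsUnit ((-(u : R)) ^ n) := (u.isUnit.neg).pow n
  exact hu.smul_left_cancel.1 h

lemma neg_mul_neg_smul (c d : R) (a : A) : -((c * -d) • a) = (c * d) • a := by
  rw [mul_neg, neg_smul, neg_neg]

/-- An entry of a column of `T` commutes with a maximal minor on the columns `T`. -/
lemma IsQuantum.mul_rowMinor_of_mem (hZ : IsQuantum u Z) {S : Finset α} {T : Finset β}
    (hST : #S = #T) {r : α} (hr : r ∈ S) {c : β} (hc : c ∈ T) :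
    Z r c * rowMinor (-(u : R)) Z S.sort T = rowMinor (-(u : R)) Z S.sort T * Z r c := by
  refine smul_pow_neg_unit_injective (u := u) (#S - 1) ?_
  rw [← hZ.sum_mul_colMinor_append hr, sum_eq_single_of_mem c hc]
  · rw [hZ.transpose.rowMinor_sort_append (notMem_erase c T), insert_erase hc, ← hZ.rowMinor_sort,
      mul_smul_comm, smul_smul, ← pow_add, above_erase_of_le le_rfl, hST, ← below_add_above hc]
    rfl
  · intro x _ hxc
    rw [hZ.transpose.rowMinor_append_singleton_of_mem ((mem_sort _).2 (mem_erase.2 ⟨hxc.symm, hc⟩)),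
      mul_zero, smul_zero]

/-- An entry of a column to the left of `T` commutes up to `u` with a maximal minor on the
columns `T`. -/
lemma IsQuantum.mul_rowMinor_of_lt (hZ : IsQuantum u Z) {S : Finset α} {T : Finset β}
    (hST : #S = #T) {r : α} (hr : r ∈ S) {c : β} (hc : ∀ x ∈ T, c < x) :
    Z r c * rowMinor (-(u : R)) Z S.sort T =
      (u : R) • (rowMinor (-(u : R)) Z S.sort T * Z r c) := by
  have hcT : c ∉ T := fun h => lt_irrefl _ (hc c h)
  have h := hZ.rowMinor_cons_of_mem (L := S.sort) ((mem_sort _).2 hr) (insert c T)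
  rw [rowMinor_cons, sum_insert hcT, erase_insert hcT] at h
  have hb : below (insert c T) c = 0 := by
    refine below_eq_zero fun y hy => ?_
    rcases mem_insert.1 hy with rfl | hy
    exacts [le_rfl, (hc y hy).le]
  rw [hb, pow_zero, one_smul] at h
  refine smul_pow_neg_unit_injective (u := u) (#S - 1) ?_
  rw [smul_comm, ← hZ.sum_mul_colMinor_append hr, eq_neg_of_add_eq_zero_left h, smul_neg, smul_sum,
    smul_sum, ← sum_neg_distrib]
  refine sum_congr rfl fun x hx => ?_
  have hcx : c ∉ T.erase x := fun h => hcT (mem_of_mem_erase h)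
  have hab : above (T.erase x) c = #S - 1 := by
    rw [above, filter_true_of_mem fun y hy => hc y (mem_of_mem_erase hy), card_erase_of_mem hx, hST]
  rw [hZ.transpose.rowMinor_sort_append hcx, ← hZ.rowMinor_sort, hab,
    ← erase_insert_of_ne (hc x hx).ne, ← below_erase_of_lt (mem_insert_self c T) (hc x hx),
    erase_insert hcT]
  simp only [mul_smul_comm, smul_smul, ← neg_smul]
  congr 1
  ring

/-- A minor commutes up to a power of `u` with the maximal minor on the last columns. -/
lemma IsQuantum.rowMinor_mul_rowMinor (hZ : IsQuantum u Z) {S : Finset α} {T : Finset β}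
    (hST : #S = #T) (hT : ∀ c ∉ T, ∀ x ∈ T, c < x) (L : List α) (hL : ∀ r ∈ L, r ∈ S)
    (C : Finset β) :
    rowMinor (-(u : R)) Z L C * rowMinor (-(u : R)) Z S.sort T =
      (u : R) ^ #(C \ T) • (rowMinor (-(u : R)) Z S.sort T * rowMinor (-(u : R)) Z L C) := by
  induction L generalizing C with
  | nil =>
    by_cases h : C = ∅
    · simp [h]
    · simp [h]
  | cons r L ih =>
    rw [rowMinor_cons, sum_mul, mul_sum, smul_sum]
    refine sum_congr rfl fun x hx => ?_
    have hr := hL r (by simp)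
    rw [smul_mul_assoc, mul_assoc, ih (fun s hs => hL s (by simp [hs])), mul_smul_comm, ← mul_assoc]
    by_cases hxT : x ∈ T
    · rw [hZ.mul_rowMinor_of_mem hST hr hxT, erase_sdiff_comm, erase_eq_of_notMem (by simp [hxT]),
        mul_smul_comm, smul_comm, mul_assoc]
    · rw [hZ.mul_rowMinor_of_lt hST hr (hT x hxT), erase_sdiff_comm,
        ← card_erase_add_one (mem_sdiff.2 ⟨hx, hxT⟩), pow_succ, mul_smul, mul_smul_comm,
        smul_mul_assoc, mul_assoc, smul_comm ((-(u : R)) ^ _), smul_comm ((-(u : R)) ^ _)]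

end QMinor

namespace QMinor

open Finset

section Permutations

/-- The permutation of `Fin (t + 1)` sending `0` to `a` and acting as `τ` on the remaining
elements. -/
def permCons {t : ℕ} (a : Fin (t + 1)) (τ : Equiv.Perm (Fin t)) : Equiv.Perm (Fin (t + 1)) :=
  (finSuccEquiv' 0).trans ((Equiv.optionCongr τ).trans (finSuccEquiv' a).symm)

@[simp]
lemma permCons_zero {t : ℕ} (a : Fin (t + 1)) (τ : Equiv.Perm (Fin t)) : permCons a τ 0 = a := by
  simp [permCons]

@[simp]
lemma permCons_succ {t : ℕ} (a : Fin (t + 1)) (τ : Equiv.Perm (Fin t)) (s : Fin t) :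
    permCons a τ s.succ = a.succAbove (τ s) := by
  have h : finSuccEquiv' (0 : Fin (t + 1)) s.succ = some s := by
    rw [← Fin.succAbove_zero, finSuccEquiv'_succAbove]
  simp [permCons, h]

lemma permCons_bijective (t : ℕ) : Function.Bijective
    fun x : Fin (t + 1) × Equiv.Perm (Fin t) => permCons x.1 x.2 := by
  rw [Fintype.bijective_iff_injective_and_card]
  constructor
  · rintro ⟨a, τ⟩ ⟨b, ρ⟩ h
    have h0 : a = b := by simpa using congrArg (fun σ => σ 0) h
    subst h0
    congr 1
    ext s : 1
    have := congrArg (fun σ => σ s.succ) h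
    simpa using this
  · simp [Fintype.card_perm, Nat.factorial_succ]

lemma card_succAbove_lt {t : ℕ} (a : Fin (t + 1)) : #{c : Fin t | a.succAbove c < a} = a := by
  rw [← card_map a.succAboveEmb, ← Fin.card_Iio a]
  congr 1
  ext x
  simp only [mem_map, mem_filter, mem_univ, true_and, mem_Iio]
  constructor
  · rintro ⟨c, hc, rfl⟩
    exact hc
  · intro hx
    obtain ⟨c, rfl⟩ := Fin.exists_succAbove_eq hx.ne
    exact ⟨c, hx, rfl⟩

lemma permLength_eq_sum {t : ℕ} (σ : Equiv.Perm (Fin t)) :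
    permLength σ = ∑ a, ∑ b, if a < b ∧ σ b < σ a then 1 else 0 := by
  rw [permLength, card_filter, Fintype.sum_prod_type]

lemma permLength_permCons {t : ℕ} (a : Fin (t + 1)) (τ : Equiv.Perm (Fin t)) :
    permLength (permCons a τ) = a + permLength τ := by
  simp only [permLength_eq_sum, Fin.sum_univ_succ, permCons_zero, permCons_succ,
    false_and, if_false, Fin.succ_pos, true_and, zero_add, Fin.not_lt_zero, Fin.succ_lt_succ_iff,
    (Fin.strictMono_succAbove a).lt_iff_lt]
  congr 1
  rw [Equiv.sum_comp τ fun c => if a.succAbove c < a then 1 else 0, ← card_filter,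
    card_succAbove_lt]

variable {R A α β : Type*} [CommRing R] [Ring A] [Algebra R A] [LinearOrder β]

/-- The expression of a quantum minor as a sum over permutations. -/
lemma sum_perm_eq_rowMinor (p : R) (Z : α → β → A) {t : ℕ} (I : Fin t → α) (J : Fin t → β)
    (hJ : StrictMono J) :
    ∑ σ : Equiv.Perm (Fin t),
      p ^ permLength σ • (List.ofFn fun s => Z (I s) (J (σ s))).prod =
      rowMinor p Z (List.ofFn I) (univ.image J) := by
  induction t with
  | zero => simp [permLength]
  | succ t ih =>
    rw [← (permCons_bijective t).sum_comp fun σ : Equiv.Perm (Fin (t + 1)) =>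
      p ^ permLength σ • (List.ofFn fun s => Z (I s) (J (σ s))).prod, Fintype.sum_prod_type,
      List.ofFn_succ, rowMinor_cons, sum_image hJ.injective.injOn]
    refine sum_congr rfl fun a _ => ?_
    have hb : below (univ.image J) (J a) = a := by
      rw [below, filter_image, card_image_of_injective _ hJ.injective]
      simp only [hJ.lt_iff_lt]
      rw [← Fin.card_Iio a]
      congr 1
      ext x
      simp
    have he : (univ.image J).erase (J a) = univ.image (J ∘ a.succAbove) := by
      rw [← image_image, Fin.image_succAbove_univ, compl_singleton, image_erase hJ.injective]
    rw [hb, he, ← ih (fun s => I s.succ) _ (hJ.comp (Fin.strictMono_succAbove a)), mul_sum,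
      smul_sum]
    refine sum_congr rfl fun τ _ => ?_
    simp only [permLength_permCons, List.ofFn_succ, permCons_zero, permCons_succ, List.prod_cons,
      Function.comp_apply, pow_add, mul_smul, mul_smul_comm]

end Permutations

lemma isQuantum_qX (R : Type*) [CommRing R] (u : Rˣ) (m n : ℕ) :
    IsQuantum u (fun (i : Fin m) (j : Fin n) => qX R u i j) where
  row i j l h := by simpa [qX] using RingQuot.mkAlgHom_rel R (qMatrixRel.row (u := u) i j l h)
  col i k j h := by simpa [qX] using RingQuot.mkAlgHom_rel R (qMatrixRel.col (u := u) i k j h)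
  antidiag i k j l h h' := by
    simpa [qX] using RingQuot.mkAlgHom_rel R (qMatrixRel.antidiag (u := u) i k j l h h')
  diag i k j l h h' := by
    simpa only [qX, map_mul, map_add, map_smul] using
      RingQuot.mkAlgHom_rel R (qMatrixRel.diag (u := u) i k j l h h')

section Grassmannian

variable {R : Type*} [CommRing R] {u : Rˣ} {m n : ℕ}

lemma qMinor_eq_rowMinor (P : DeltaIdx m n) :
    qMinor R u P = rowMinor (-(u : R)) (qX R u) (List.ofFn P.I) (univ.image P.J) :=
  sum_perm_eq_rowMinor _ _ _ _ P.J.strictMono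

lemma qMaxMinorSet_eq_rowMinor (S : Finset (Fin n)) :
    qMaxMinorSet (m := m) R u S =
      rowMinor (-(u : R)) (qX R u) (univ : Finset (Fin m)).sort S := by
  unfold qMaxMinorSet
  split_ifs with h
  · have hS : univ.image (S.orderEmbOfFin h) = S := by
      rw [image_orderEmbOfFin_univ]
    conv_rhs => rw [Fin.sort_univ, ← List.ofFn_id, ← hS]
    exact sum_perm_eq_rowMinor _ _ _ _ (S.orderEmbOfFin h).strictMono
  · rw [rowMinor_eq_zero_of_card_ne]
    simpa using h

/-- The last `m` of the `n + m` columns. -/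
def lastCols (m n : ℕ) : Finset (Fin (n + m)) := univ.image fun i : Fin m => Fin.natAdd n i

/-- The column set `(J ∪ {n+1,…,n+m}) ∖ {n+m+1-i | i ∈ L}`. -/
def imageSet (L : List (Fin m)) (J : Finset (Fin n)) : Finset (Fin (n + m)) :=
  (J.image (Fin.castLE (Nat.le_add_right n m)) ∪ lastCols m n) \
    L.toFinset.image fun i => Fin.natAdd n i.rev

lemma deltaImage_eq_imageSet (P : DeltaIdx m n) :
    deltaImage P = imageSet (List.ofFn P.I) (univ.image P.J) := by
  rw [deltaImage, imageSet, lastCols, image_image]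
  congr 1
  ext x
  simp [List.mem_ofFn]

lemma mem_lastCols {x : Fin (n + m)} : x ∈ lastCols m n ↔ n ≤ (x : ℕ) := by
  simp only [lastCols, mem_image, mem_univ, true_and]
  constructor
  · rintro ⟨i, rfl⟩
    simp
  · intro h
    exact ⟨⟨x - n, by omega⟩, by ext; simp; omega⟩

lemma card_lastCols : #(lastCols m n) = m := by
  rw [lastCols, card_image_of_injective _ (Fin.natAdd_injective m n), card_univ, Fintype.card_fin]

lemma castLE_notMem_lastCols (x : Fin n) :
    Fin.castLE (Nat.le_add_right n m) x ∉ lastCols m n := by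
  simp [mem_lastCols]

lemma natAdd_mem_lastCols (i : Fin m) : Fin.natAdd n i ∈ lastCols m n := by
  simp [mem_lastCols]

lemma castLE_ne_natAdd (x : Fin n) (i : Fin m) :
    Fin.castLE (Nat.le_add_right n m) x ≠ Fin.natAdd n i :=
  fun h => castLE_notMem_lastCols x (h ▸ natAdd_mem_lastCols i)

lemma natAdd_rev_injective : Function.Injective fun i : Fin m => Fin.natAdd n i.rev :=
  (Fin.natAdd_injective m n).comp Fin.rev_injective

lemma castLE_injective : Function.Injective (Fin.castLE (Nat.le_add_right n m)) :=
  Fin.castLE_injective _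

lemma imageSet_eq_union (L : List (Fin m)) (J : Finset (Fin n)) :
    imageSet L J = J.image (Fin.castLE (Nat.le_add_right n m)) ∪
      (lastCols m n \ L.toFinset.image fun i => Fin.natAdd n i.rev) := by
  rw [imageSet, union_sdiff_distrib]
  congr 1
  refine sdiff_eq_self_of_disjoint (disjoint_left.2 ?_)
  simp only [mem_image]
  rintro _ ⟨x, _, rfl⟩ ⟨i, _, h⟩
  exact castLE_ne_natAdd _ _ h.symm

lemma imageSet_sdiff_lastCols (L : List (Fin m)) (J : Finset (Fin n)) :
    imageSet L J \ lastCols m n = J.image (Fin.castLE (Nat.le_add_right n m)) := by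
  ext x
  rw [imageSet_eq_union]
  simp only [mem_sdiff, mem_union, mem_image]
  constructor
  · tauto
  · rintro ⟨y, hy, rfl⟩
    exact ⟨Or.inl ⟨y, hy, rfl⟩, castLE_notMem_lastCols y⟩

lemma card_imageSet_sdiff_lastCols (L : List (Fin m)) (J : Finset (Fin n)) :
    #(imageSet L J \ lastCols m n) = #J := by
  rw [imageSet_sdiff_lastCols, card_image_of_injective _ castLE_injective]

lemma imageSet_singleton (i : Fin m) (x : Fin n) :
    imageSet [i] {x} = insert (Fin.castLE (Nat.le_add_right n m) x)
      ((lastCols m n).erase (Fin.natAdd n i.rev)) := by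
  rw [imageSet_eq_union]
  simp [sdiff_singleton_eq_erase]

lemma imageSet_erase (L : List (Fin m)) (J : Finset (Fin n)) (x : Fin n) :
    (imageSet L J).erase (Fin.castLE (Nat.le_add_right n m) x) = imageSet L (J.erase x) := by
  rw [imageSet_eq_union, imageSet_eq_union, erase_union_distrib, image_erase castLE_injective]
  congr 1
  exact erase_eq_of_notMem fun h => castLE_notMem_lastCols x (mem_sdiff.1 h).1

lemma imageSet_cons (i : Fin m) (L : List (Fin m)) (J : Finset (Fin n)) :
    imageSet (i :: L) J = (imageSet L J).erase (Fin.natAdd n i.rev) := by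
  rw [imageSet, imageSet, List.toFinset_cons, image_insert, sdiff_insert]

lemma imageSet_sdiff_erase {i : Fin m} {L : List (Fin m)} (hi : i ∉ L) (J : Finset (Fin n)) :
    imageSet L J \ (lastCols m n).erase (Fin.natAdd n i.rev) =
      insert (Fin.natAdd n i.rev) (J.image (Fin.castLE (Nat.le_add_right n m))) := by
  rw [sdiff_erase, imageSet_sdiff_lastCols]
  rw [imageSet_eq_union, mem_union, mem_sdiff]
  refine Or.inr ⟨natAdd_mem_lastCols _, ?_⟩
  rw [mem_image]
  rintro ⟨s, hs, h⟩
  rw [natAdd_rev_injective h] at hs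
  exact hi (List.mem_toFinset.1 hs)

lemma below_imageSet_castLE (L : List (Fin m)) (J : Finset (Fin n)) (x : Fin n) :
    below (imageSet L J) (Fin.castLE (Nat.le_add_right n m) x) = below J x := by
  rw [below, below, imageSet_eq_union, filter_union, filter_image,
    filter_eq_empty_iff (s := lastCols m n \ _).2, union_empty, card_image_of_injective _ castLE_injective]
  · rfl
  · intro y hy
    have := mem_lastCols.1 (mem_sdiff.1 hy).1
    rw [Fin.lt_def, Fin.val_castLE]
    omega

lemma above_lastCols_erase (i : Fin m) (x : Fin n) :
    above ((lastCols m n).erase (Fin.natAdd n i)) (Fin.castLE (Nat.le_add_right n m) x) =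
      m - 1 := by
  rw [above, filter_true_of_mem, card_erase_of_mem (natAdd_mem_lastCols i), card_lastCols]
  intro y hy
  have := mem_lastCols.1 (mem_of_mem_erase hy)
  rw [Fin.lt_def, Fin.val_castLE]
  omega

lemma below_add_above_natAdd {i : Fin m} {L : List (Fin m)} (hi : ∀ s ∈ L, i < s)
    (hL : L.Nodup) {J : Finset (Fin n)} (hJ : #J = L.length + 1) :
    below (imageSet L J) (Fin.natAdd n i.rev) +
      above ((lastCols m n).erase (Fin.natAdd n i.rev)) (Fin.natAdd n i.rev) = m := by
  have hmem : ∀ s, s ∈ L → Fin.natAdd n s.rev < Fin.natAdd n i.rev := by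
    intro s hs
    have := hi s hs
    simp only [Fin.lt_def, Fin.val_natAdd, Fin.val_rev] at this ⊢
    omega
  have hB : below (imageSet L J) (Fin.natAdd n i.rev) + L.length =
      #J + below (lastCols m n) (Fin.natAdd n i.rev) := by
    have hsub : (L.toFinset.image fun i => Fin.natAdd n i.rev) ⊆
        {y ∈ lastCols m n | y < Fin.natAdd n i.rev} := by
      intro y hy
      obtain ⟨s, hs, rfl⟩ := mem_image.1 hy
      exact mem_filter.2 ⟨natAdd_mem_lastCols _, hmem s (List.mem_toFinset.1 hs)⟩
    have hcard : #(L.toFinset.image fun i => Fin.natAdd n i.rev) = L.length := by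
      rw [card_image_of_injective _ natAdd_rev_injective, List.toFinset_card_of_nodup hL]
    rw [below, below, imageSet_eq_union, filter_union, card_union_of_disjoint,
      filter_true_of_mem, card_image_of_injective _ castLE_injective, add_assoc]
    · congr 1
      rw [← hcard, ← card_sdiff_add_card_eq_card hsub]
      congr 2
      ext y
      simp only [mem_filter, mem_sdiff]
      tauto
    · intro y hy
      obtain ⟨x, _, rfl⟩ := mem_image.1 hy
      simp only [Fin.lt_def, Fin.val_natAdd, Fin.val_castLE]
      omega
    · refine disjoint_left.2 fun y hy hy' => ?_
      obtain ⟨x, _, rfl⟩ := mem_image.1 (mem_filter.1 hy).1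
      exact castLE_notMem_lastCols x (mem_sdiff.1 (mem_filter.1 hy').1).1
  have hM := below_add_above (natAdd_mem_lastCols (n := n) i.rev)
  rw [card_lastCols] at hM
  rw [above_erase_of_le le_rfl]
  omega

/-- The quantum Plücker relation used to expand the minor `imageSet (i :: L) J`. -/
lemma pluecker_imageSet {i : Fin m} {L : List (Fin m)} (hi : ∀ s ∈ L, i < s) (hL : L.Nodup)
    {J : Finset (Fin n)} (hJ : #J = L.length + 1) :
    ∑ x ∈ J, (-(u : R)) ^ below J x •
      (grSetMinor (m := m) R u (imageSet [i] {x}) * grSetMinor R u (imageSet L (J.erase x))) =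
      (u : R) • (grSetMinor R u (lastCols m n) * grSetMinor R u (imageSet (i :: L) J)) := by
  have hiL : i ∉ L := fun h => lt_irrefl _ (hi i h)
  apply Subtype.ext
  simp only [AddSubmonoidClass.coe_finsetSum, Subalgebra.coe_smul, Subalgebra.coe_mul, grSetMinor,
    qMaxMinorSet_eq_rowMinor]
  have h := (isQuantum_qX R u m (n + m)).pluecker univ
    ((lastCols m n).erase (Fin.natAdd n i.rev)) (imageSet L J)
  rw [imageSet_sdiff_erase hiL, sum_insert, sum_image castLE_injective.injOn,
    below_add_above_natAdd hi hL hJ, insert_erase (natAdd_mem_lastCols _), ← imageSet_cons] at h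
  · refine smul_pow_neg_unit_injective (u := u) (m - 1) ?_
    have hm : (-(u : R)) ^ m = (-(u : R)) ^ (m - 1) * -(u : R) := by
      rw [← pow_succ, Nat.sub_add_cancel i.pos]
    have h' := eq_neg_of_add_eq_zero_right h
    simp only [below_imageSet_castLE, above_lastCols_erase, imageSet_erase] at h'
    rw [smul_sum]
    refine (sum_congr rfl fun x _ => ?_).trans (h'.trans ?_)
    · rw [imageSet_singleton, smul_smul, ← pow_add, Nat.add_comm (m - 1)]
    · rw [hm, smul_smul]
      exact neg_mul_neg_smul _ _ _
  · rw [mem_image]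
    rintro ⟨x, _, h⟩
    exact castLE_ne_natAdd _ _ h

lemma grSetMinor_imageSet_mul (L : List (Fin m)) (J : Finset (Fin n)) :
    grSetMinor (m := m) R u (imageSet L J) * grSetMinor R u (lastCols m n) =
      (u : R) ^ #J • (grSetMinor R u (lastCols m n) * grSetMinor R u (imageSet L J)) := by
  apply Subtype.ext
  simp only [Subalgebra.coe_smul, Subalgebra.coe_mul, grSetMinor, qMaxMinorSet_eq_rowMinor]
  rw [← card_imageSet_sdiff_lastCols L J]
  refine (isQuantum_qX R u m (n + m)).rowMinor_mul_rowMinor (by simp [card_lastCols]) ?_ _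
    (by simp) _
  intro c hc x hx
  rw [mem_lastCols] at hc hx
  rw [Fin.lt_def]
  omega

/-- A matrix whose entries are the dehomogenised maximal minors `imageSet [i] {j}` has as its
quantum minors the dehomogenised maximal minors `imageSet L J`. -/
lemma rowMinor_dehomogenised {T : Type*} [Ring T] [Algebra R T]
    (Ψ : QuantumGrassmannian R u m (n + m) →ₐ[R] T) (v : T)
    (hv1 : Ψ (grSetMinor R u (lastCols m n)) * v = 1)
    (hv2 : v * Ψ (grSetMinor R u (lastCols m n)) = 1) (X : Fin m → Fin n → T)
    (hX : ∀ i j, X i j = Ψ (grSetMinor R u (imageSet [i] {j})) * v)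
    (L : List (Fin m)) (hL : L.Pairwise (· < ·)) (J : Finset (Fin n)) (hJ : #J = L.length) :
    rowMinor (-(u : R)) X L J = Ψ (grSetMinor R u (imageSet L J)) * v := by
  induction L generalizing J with
  | nil =>
    obtain rfl : J = ∅ := card_eq_zero.1 hJ
    simp [imageSet, hv1]
  | cons i L ih =>
    obtain ⟨hi, hL⟩ := List.pairwise_cons.1 hL
    have hcomm : ∀ L' J', Ψ (grSetMinor R u (imageSet L' J')) * Ψ (grSetMinor R u (lastCols m n)) =
        (u : R) ^ #J' • (Ψ (grSetMinor R u (lastCols m n)) *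
          Ψ (grSetMinor R u (imageSet L' J'))) := by
      intro L' J'
      rw [← map_mul, grSetMinor_imageSet_mul, map_smul, map_mul]
    have hv : ∀ L' J', v * Ψ (grSetMinor R u (imageSet L' J')) =
        (u : R) ^ #J' • (Ψ (grSetMinor R u (imageSet L' J')) * v) := by
      intro L' J'
      calc v * Ψ (grSetMinor R u (imageSet L' J'))
          = v * (Ψ (grSetMinor R u (imageSet L' J')) * Ψ (grSetMinor R u (lastCols m n))) * v := by
            rw [mul_assoc, mul_assoc, hv1, mul_one]
        _ = _ := by
            rw [hcomm, mul_smul_comm, smul_mul_assoc, ← mul_assoc v, hv2, one_mul]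
    have hpl := congrArg Ψ (pluecker_imageSet (R := R) (u := u) hi
      (hL.imp ne_of_lt) hJ)
    simp only [map_sum, map_smul, map_mul] at hpl
    have hterm : ∀ x ∈ J, (-(u : R)) ^ below J x • (X i x * rowMinor (-(u : R)) X L (J.erase x)) =
        (u : R) ^ L.length • (((-(u : R)) ^ below J x • (Ψ (grSetMinor R u (imageSet [i] {x})) *
          Ψ (grSetMinor R u (imageSet L (J.erase x))))) * (v * v)) := by
      intro x hx
      have hJx : #(J.erase x) = L.length := by
        rw [card_erase_of_mem hx, hJ, List.length_cons, Nat.add_sub_cancel]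
      rw [ih hL _ hJx, hX, mul_assoc, ← mul_assoc v, hv, hJx]
      simp only [smul_mul_assoc, mul_smul_comm, mul_assoc]
      rw [smul_comm]
    rw [rowMinor_cons, sum_congr rfl hterm, ← smul_sum, ← sum_mul, hpl, smul_mul_assoc, smul_smul,
      ← pow_succ, ← smul_mul_assoc, ← List.length_cons (a := i), ← hJ, ← hcomm, mul_assoc,
      ← mul_assoc _ v, hv1, one_mul]

end Grassmannian

end QMinor

/-- Let `q ≠ 0` in a field `k` and `m ≤ n` positive integers.  The
dehomogenisation isomorphism
`D_{m,n} : O_q(M_{m,n}(k))[y,y⁻¹;φ] → O_q(G_{m,n+m}(k))[[n+1,…,n+m]⁻¹]` — modelled by its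
restriction `D` to `O_q(M_{m,n}(k))`, with values in any `k`-algebra `T` receiving the
quantum grassmannian `O_q(G_{m,n+m}(k))` via `Ψ`, in which `Ψ([n+1,…,n+m])` has the
two-sided inverse `v`, and determined on the generators by
`D(X i j) = Ψ([{j, n+1,…,n+m} ∖ {n+m+1−i}])·v` — satisfies, for every index pair
`(I,J) ∈ Δ_{m,n}`, the identity `D([I|J]) = Ψ([K_{(I,J)}])·v`. -/
theorem dehomogenisation_on_minors (k : Type*) [Field k] (q : k) (hq : q ≠ 0)
    (m n : ℕ) (hm : 0 < m) (hmn : m ≤ n)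
    (T : Type*) [Ring T] [Algebra k T]
    (Ψ : QuantumGrassmannian k (Units.mk0 q hq) m (n + m) →ₐ[k] T) (v : T)
    (hv1 : Ψ (grSetMinor k (Units.mk0 q hq)
        (Finset.univ.image fun i : Fin m => Fin.natAdd n i)) * v = 1)
    (hv2 : v * Ψ (grSetMinor k (Units.mk0 q hq)
        (Finset.univ.image fun i : Fin m => Fin.natAdd n i)) = 1)
    (D : QuantumMat k (Units.mk0 q hq) m n →ₐ[k] T)
    (hD : ∀ (i : Fin m) (j : Fin n),
      D (qX k (Units.mk0 q hq) i j) =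
        Ψ (grSetMinor k (Units.mk0 q hq)
            (deltaImage ⟨1, Nat.one_pos, hm, singleEmb i, singleEmb j⟩)) * v)
    (P : DeltaIdx m n) :
    D (qMinor k (Units.mk0 q hq) P) =
      Ψ (grSetMinor k (Units.mk0 q hq) (deltaImage P)) * v := by
  rw [QMinor.qMinor_eq_rowMinor, QMinor.map_rowMinor, QMinor.deltaImage_eq_imageSet]
  refine QMinor.rowMinor_dehomogenised Ψ v hv1 hv2 _ (fun i j => ?_) _ ?_ _ ?_
  · rw [hD, QMinor.deltaImage_eq_imageSet]
    rfl
  · exact List.pairwise_ofFn.2 fun _ _ h => P.I.strictMono h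
  · rw [Finset.card_image_of_injective _ P.J.injective, List.length_ofFn, Finset.card_univ,
      Fintype.card_fin]
end
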